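/- arXiv:1804.02776 — 4 statements merged into one kernel-verified Lean document; each statement's English description precedes it below -/
import Mathlib

section
/- Fix r ∈ ℕ and σ ∈ S_r, and for each n ≥ r let σ_n ∈ S_n be the permutation acting as σ on {1,...,r} and fixing the remaining n - r points. Then there exists n₀ such that for every n ≥ n₀ the standard representation rules for σ_n in S_n: for every irreducible complex character χ of S_n other than the trivial and sign characters, χ̃(σ_n) ≤ (c₁(σ_n)-1)/(n-1) = (n - r + c₁(σ) - 1)/(n-1). -/
open CategoryTheory

/-- `c₁(σ)`: the number of fixed points of a permutation. -/
def fixCount {n : ℕ} (σ : Equiv.Perm (Fin n)) : ℕ :=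
  (Finset.univ.filter fun x => σ x = x).card

/-- `c_ℓ(σ)`: the number of `ℓ`-cycles of a permutation (for `ℓ ≥ 2`). -/
def cyc {n : ℕ} (ℓ : ℕ) (σ : Equiv.Perm (Fin n)) : ℕ :=
  Multiset.count ℓ σ.cycleType

/-- The (real-valued) normalized character `χ̃(σ) = χ(σ)/χ(1)` of `V` at `σ`. -/
noncomputable def normChar {n : ℕ} (V : FDRep ℂ (Equiv.Perm (Fin n)))
    (σ : Equiv.Perm (Fin n)) : ℝ :=
  (V.character σ / V.character 1).re

/-- `V` is an irreducible representation whose character is neither the trivial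
character nor the sign character. -/
def IsNontrivIrr {n : ℕ} (V : FDRep ℂ (Equiv.Perm (Fin n))) : Prop :=
  Simple V ∧ V.character ≠ (fun _ => 1) ∧
    V.character ≠ (fun σ => ((Equiv.Perm.sign σ : ℤ) : ℂ))

/-- The maximum of the normalized characters `F₁(σ), …, F₈(σ)` at `σ` of the eight
irreps `EIGHT_n = {(n-1,1), (n-2,2), (n-3,3), (n-3,2,1), (n-4,4),
(n-1,1)ᵗ, (n-2,2)ᵗ, (n-2,1,1)ᵗ}`. -/
noncomputable def maxF (n : ℕ) (σ : Equiv.Perm (Fin n)) : ℝ :=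
  let c1 : ℝ := fixCount σ
  let c2 : ℝ := cyc 2 σ
  let c3 : ℝ := cyc 3 σ
  let c4 : ℝ := cyc 4 σ
  let e : ℝ := ((Equiv.Perm.sign σ : ℤ) : ℝ)
  let N : ℝ := n
  let F1 := (c1 - 1) / (N - 1)
  let F2 := (c1 * (c1 - 3) / 2 + c2) / (N * (N - 3) / 2)
  let F3 := (c1 * (c1 - 1) * (c1 - 5) / 6 + (c1 - 1) * c2 + c3) / (N * (N - 1) * (N - 5) / 6)
  let F4 := (c1 * (c1 - 2) * (c1 - 4) / 3 - c3) / (N * (N - 2) * (N - 4) / 3)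
  let F5 := (c1 * (c1 - 1) * (c1 - 2) * (c1 - 7) / 24 + (c1 ^ 2 - 3 * c1 - 1) * c2 / 2
      + c2 ^ 2 / 2 + (c1 - 1) * c3 + c4) / (N * (N - 1) * (N - 2) * (N - 7) / 24)
  let F6 := e * F1
  let F7 := e * F2
  let F8 := e * ((c1 - 1) * (c1 - 2) / 2 - c2) / ((N - 1) * (N - 2) / 2)
  max (max (max F1 F2) (max F3 F4)) (max (max F5 F6) (max F7 F8))

open Module

lemma re_lt_one_of_pow_eq_one {m : ℕ} (hm : m ≠ 0) {z : ℂ} (hz : z ^ m = 1) (h1 : z ≠ 1) :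
    z.re < 1 := by
  have hn : ‖z‖ = 1 := Complex.norm_eq_one_of_pow_eq_one hz hm
  refine lt_of_le_of_ne (hn ▸ Complex.re_le_norm z) fun h => h1 ?_
  have h2 : z.re * z.re + z.im * z.im = 1 := by
    rw [← Complex.normSq_apply, Complex.normSq_eq_norm_sq, hn, one_pow]
  have h3 : z.im = 0 := by
    rw [h] at h2
    nlinarith
  exact Complex.ext h h3

lemma exists_gap_of_pow_eq_one {m : ℕ} (hm : m ≠ 0) :
    ∃ ε : ℝ, 0 < ε ∧ ∀ z : ℂ, z ^ m = 1 → z ≠ 1 → z.re ≤ 1 - ε := by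
  have hfin : {z : ℂ | z ^ m = 1 ∧ z ≠ 1}.Finite := by
    refine (Polynomial.nthRoots m (1 : ℂ)).toFinset.finite_toSet.subset fun z hz => ?_
    simpa [Polynomial.mem_nthRoots (Nat.pos_of_ne_zero hm)] using hz.1
  rcases {z : ℂ | z ^ m = 1 ∧ z ≠ 1}.eq_empty_or_nonempty with h | h
  · refine ⟨1, one_pos, fun z hz h1 => ?_⟩
    have : z ∈ {z : ℂ | z ^ m = 1 ∧ z ≠ 1} := ⟨hz, h1⟩
    simp [h] at this
  · obtain ⟨z₀, hz₀, hmax⟩ := Set.exists_max_image _ Complex.re hfin h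
    refine ⟨1 - z₀.re, sub_pos.2 (re_lt_one_of_pow_eq_one hm hz₀.1 hz₀.2), fun z hz h1 => ?_⟩
    linarith [hmax z ⟨hz, h1⟩]

/-- An endomorphism of finite order other than the identity has trace bounded away from the
dimension, uniformly for a given exponent. -/
lemma exists_trace_gap {m : ℕ} (hm : m ≠ 0) :
    ∃ ε : ℝ, 0 < ε ∧ ∀ (V : Type) [AddCommGroup V] [Module ℂ V] [FiniteDimensional ℂ V]
      (T : End ℂ V), T ^ m = 1 → T ≠ 1 → (LinearMap.trace ℂ V T).re ≤ finrank ℂ V - ε := by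
  obtain ⟨ε, hε, hgap⟩ := exists_gap_of_pow_eq_one hm
  refine ⟨ε, hε, fun V _ _ _ T hT hT1 => ?_⟩
  have hsplit : T.charpoly.Splits := IsAlgClosed.splits _
  have hcard : T.charpoly.roots.card = finrank ℂ V := by
    rw [← hsplit.natDegree_eq_card_roots, LinearMap.charpoly_natDegree]
  have hpow : ∀ z ∈ T.charpoly.roots, z ^ m = 1 := by
    intro z hz
    have hz' : T.HasEigenvalue z := by
      rw [End.hasEigenvalue_iff_isRoot_charpoly]
      exact Polynomial.isRoot_of_mem_roots hz
    obtain ⟨v, hv⟩ := hz'.exists_hasEigenvector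
    have := hv.pow_apply m
    rw [hT, End.one_apply] at this
    have h2 : (z ^ m - 1) • v = 0 := by rw [sub_smul, ← this, one_smul, sub_self]
    exact sub_eq_zero.1 ((smul_eq_zero.1 h2).resolve_right hv.2)
  have hle : ∀ z ∈ T.charpoly.roots, z.re ≤ 1 := fun z hz =>
    (Complex.re_le_norm z).trans_eq (Complex.norm_eq_one_of_pow_eq_one (hpow z hz) hm)
  obtain ⟨z₀, hz₀, hne⟩ : ∃ z ∈ T.charpoly.roots, z ≠ 1 := by
    by_contra! hall
    have hrep := Multiset.eq_replicate_card.2 hall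
    have hnil : IsNilpotent (T - 1) := by
      refine ⟨T.charpoly.roots.card, ?_⟩
      have h0 := LinearMap.aeval_self_charpoly T
      rw [hsplit.eq_prod_roots_of_monic (LinearMap.charpoly_monic T), hrep] at h0
      simpa using h0
    have hss : (T - 1).IsSemisimple := by
      have : T.IsSemisimple := End.isSemisimple_of_squarefree_aeval_eq_zero
        (Polynomial.separable_X_pow_sub_C (1 : ℂ) (Nat.cast_ne_zero.2 hm) one_ne_zero).squarefree
        (by simp [hT])
      have h1 := (End.isSemisimple_sub_algebraMap_iff (f := T) (μ := (1 : ℂ))).2 this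
      simpa using h1
    exact hT1 (sub_eq_zero.1 (End.eq_zero_of_isNilpotent_isSemisimple hnil hss))
  obtain ⟨s, hs⟩ := Multiset.exists_cons_of_mem hz₀
  have hsum : ∀ s : Multiset ℂ, (∀ z ∈ s, z.re ≤ 1) → s.sum.re ≤ s.card := by
    intro s
    induction s using Multiset.induction_on with
    | empty => simp
    | cons a s ih =>
      intro h
      have h1 := h a (Multiset.mem_cons_self a s)
      have h2 := ih fun z hz => h z (Multiset.mem_cons_of_mem hz)
      simp only [Multiset.sum_cons, Complex.add_re, Multiset.card_cons, Nat.cast_add, Nat.cast_one]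
      linarith
  have h1 := hgap z₀ (hpow z₀ hz₀) hne
  have h2 := hsum s fun z hz => hle z (hs ▸ Multiset.mem_cons_of_mem hz)
  rw [End.trace_eq_sum_roots_charpoly_of_splits hsplit, ← hcard, hs]
  simp only [Multiset.sum_cons, Complex.add_re, Multiset.card_cons, Nat.cast_add, Nat.cast_one]
  linarith

lemma trace_eq_add_of_isCompl {V : Type*} [AddCommGroup V] [Module ℂ V] [FiniteDimensional ℂ V]
    {p q : Submodule ℂ V} (h : IsCompl p q) {f : V →ₗ[ℂ] V} (hp : ∀ v ∈ p, f v ∈ p)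
    (hq : ∀ v ∈ q, f v ∈ q) :
    LinearMap.trace ℂ V f =
      LinearMap.trace ℂ p (f.restrict hp) + LinearMap.trace ℂ q (f.restrict hq) := by
  let A : Bool → Submodule ℂ V := fun b => cond b p q
  have hA : DirectSum.IsInternal A :=
    (DirectSum.isInternal_submodule_iff_isCompl A (i := true) (j := false) (by simp)
      (by ext b; cases b <;> simp)).2 h
  have hf : ∀ b, Set.MapsTo f (A b) (A b) := by
    rintro (_ | _)
    exacts [hq, hp]
  rw [LinearMap.trace_eq_sum_trace_restrict hA hf, Fintype.sum_bool]
  rfl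

section Representations

open Equiv Equiv.Perm

variable {n : ℕ} {V : Type} [AddCommGroup V] [Module ℂ V]

/-- The `e`-th power of the sign character, with complex values. -/
def signChar (n e : ℕ) : Perm (Fin n) →* ℂ where
  toFun g := ((sign g : ℤ) : ℂ) ^ e
  map_one' := by simp
  map_mul' g h := by simp [mul_pow]

lemma signChar_apply (e : ℕ) (g : Perm (Fin n)) :
    signChar n e g = ((sign g : ℤ) : ℂ) ^ e := rfl

lemma signChar_eq_one_or (e : ℕ) (g : Perm (Fin n)) :
    signChar n e g = 1 ∨ signChar n e g = -1 := by
  rw [signChar_apply]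
  rcases Int.units_eq_one_or (sign g) with h | h
  · simp [h]
  · simpa [h] using neg_one_pow_eq_or ℂ e

lemma signChar_mul_self (e : ℕ) (g : Perm (Fin n)) :
    signChar n e g * signChar n e g = 1 := by
  rcases signChar_eq_one_or e g with h | h <;> simp [h]

/-- A representation of `S_n` with no nonzero vector that is invariant or transforms by the sign,
i.e. without trivial or sign constituents. -/
def LacksSignVectors (ρ : Representation ℂ (Perm (Fin n)) V) : Prop :=
  ∀ (e : ℕ) (v : V), (∀ g, ρ g v = signChar n e g • v) → v = 0

lemma LacksSignVectors.toRepresentation {ρ : Representation ℂ (Perm (Fin n)) V}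
    (h : LacksSignVectors ρ) (W : Subrepresentation ρ) : LacksSignVectors W.toRepresentation :=
  fun e v hv => Subtype.ext (h e v fun g => congrArg Subtype.val (hv g))

/-- If every representation lacking sign vectors has a nonzero subrepresentation satisfying a
given trace bound, then all of them satisfy this bound. -/
lemma trace_re_le_of_exists_subrepresentation (g : Perm (Fin n)) (c : ℝ)
    (H : ∀ (V : Type) [AddCommGroup V] [Module ℂ V] [FiniteDimensional ℂ V] [Nontrivial V]
      (ρ : Representation ℂ (Perm (Fin n)) V), LacksSignVectors ρ →
      ∃ W : Subrepresentation ρ, W.toSubmodule ≠ ⊥ ∧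
        (LinearMap.trace ℂ W.toSubmodule (W.toRepresentation g)).re ≤
          c * finrank ℂ W.toSubmodule)
    (V : Type) [AddCommGroup V] [Module ℂ V] [FiniteDimensional ℂ V]
    (ρ : Representation ℂ (Perm (Fin n)) V) (hρ : LacksSignVectors ρ) :
    (LinearMap.trace ℂ V (ρ g)).re ≤ c * finrank ℂ V := by
  induction hd : finrank ℂ V using Nat.strong_induction_on generalizing V with
  | _ d ih =>
  rcases subsingleton_or_nontrivial V with hV | hV
  · have h0 : ρ g = 0 := Subsingleton.elim _ _
    have h1 : d = 0 := by rw [← hd, finrank_zero_of_subsingleton]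
    simp [h0, h1]
  obtain ⟨W, hW, hWle⟩ := H V ρ hρ
  obtain ⟨U, hU⟩ := exists_isCompl W
  have hWU : IsCompl W.toSubmodule U.toSubmodule := by
    rw [isCompl_iff, disjoint_iff, codisjoint_iff] at hU ⊢
    exact ⟨congrArg Subrepresentation.toSubmodule hU.1, congrArg Subrepresentation.toSubmodule hU.2⟩
  have hdim := Submodule.finrank_add_eq_of_isCompl hWU
  have hpos : 0 < finrank ℂ W.toSubmodule := by
    rw [finrank_pos_iff, Submodule.nontrivial_iff_ne_bot]
    exact hW
  have hUle := ih _ (by omega) U.toSubmodule U.toRepresentation (hρ.toRepresentation U) rfl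
  rw [trace_eq_add_of_isCompl hWU (W.apply_mem_toSubmodule g) (U.apply_mem_toSubmodule g),
    Complex.add_re, ← hd, ← hdim, Nat.cast_add, mul_add]
  exact add_le_add hWle hUle

lemma LacksSignVectors.apply_ne_one (hn : 5 ≤ n) [Nontrivial V]
    {ρ : Representation ℂ (Perm (Fin n)) V} (h : LacksSignVectors ρ) {g : Perm (Fin n)}
    (hg : g ≠ 1) : ρ g ≠ 1 := by
  intro hρg
  have hker : Nontrivial (MonoidHom.ker ρ) :=
    (Subgroup.nontrivial_iff_exists_ne_one _).2 ⟨g, MonoidHom.mem_ker.2 hρg, hg⟩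
  have heven : ∀ k : Perm (Fin n), sign k = 1 → ρ k = 1 := fun k hk =>
    MonoidHom.mem_ker.1 (alternatingGroup_le_of_normal (by simpa using hn) hker
      (mem_alternatingGroup.2 hk))
  obtain ⟨w, hw⟩ := exists_ne (0 : V)
  have h01 : (⟨0, by omega⟩ : Fin n) ≠ ⟨1, by omega⟩ := by simp
  set τ : Perm (Fin n) := swap ⟨0, by omega⟩ ⟨1, by omega⟩ with hτ
  have hsτ : sign τ = -1 := sign_swap h01
  have hττ : τ * τ = 1 := swap_mul_self _ _
  have hodd : ∀ k : Perm (Fin n), sign k = -1 → ρ k = ρ τ := fun k hk => by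
    have h1 : ρ (τ * k) = 1 := heven _ (by simp [hsτ, hk])
    calc ρ k = ρ (τ * (τ * k)) := by rw [← mul_assoc, hττ, one_mul]
      _ = ρ τ := by rw [map_mul, h1, mul_one]
  have hττw : ρ τ (ρ τ w) = w := by
    rw [← Module.End.mul_apply, ← map_mul, hττ, map_one, Module.End.one_apply]
  have hzero : w + ρ τ w = 0 := by
    refine h 0 _ fun k => ?_
    rcases Int.units_eq_one_or (sign k) with hk | hk
    · simp [heven k hk, signChar_apply]
    · simp [hodd k hk, signChar_apply, hττw, add_comm]
  refine hw (h 1 w fun k => ?_)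
  rcases Int.units_eq_one_or (sign k) with hk | hk
  · simp [heven k hk, signChar_apply, hk]
  · simp [hodd k hk, signChar_apply, hk, eq_neg_of_add_eq_zero_right hzero]

/-- The subrepresentation generated by a vector. -/
def cyclicSubrepresentation (ρ : Representation ℂ (Perm (Fin n)) V) (v : V) :
    Subrepresentation ρ where
  toSubmodule := Submodule.span ℂ (Set.range fun g => ρ g v)
  apply_mem_toSubmodule g w hw := by
    induction hw using Submodule.span_induction with
    | mem x hx =>
      obtain ⟨k, rfl⟩ := hx
      exact Submodule.subset_span ⟨g * k, by simp⟩
    | zero => simp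
    | add x y _ _ hx hy => rw [map_add]; exact Submodule.add_mem _ hx hy
    | smul a x _ hx => rw [map_smul]; exact Submodule.smul_mem _ a hx

lemma exists_uniform_trace_gap (hn : 5 ≤ n) {g : Perm (Fin n)} (hg : g ≠ 1) :
    ∃ δ : ℝ, 0 < δ ∧ ∀ (V : Type) [AddCommGroup V] [Module ℂ V] [FiniteDimensional ℂ V]
      (ρ : Representation ℂ (Perm (Fin n)) V), LacksSignVectors ρ →
      (LinearMap.trace ℂ V (ρ g)).re ≤ (1 - δ) * finrank ℂ V := by
  obtain ⟨ε, hε, hgap⟩ := exists_trace_gap (orderOf_pos g).ne'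
  have hcard : (0 : ℝ) < Fintype.card (Perm (Fin n)) := by exact_mod_cast Fintype.card_pos
  refine ⟨ε / Fintype.card (Perm (Fin n)), by positivity,
    trace_re_le_of_exists_subrepresentation g _ fun V _ _ _ _ ρ hρ => ?_⟩
  obtain ⟨v, hv⟩ := exists_ne (0 : V)
  let W := cyclicSubrepresentation ρ v
  have hvW : v ∈ W.toSubmodule := Submodule.subset_span ⟨1, by simp⟩
  have hW : W.toSubmodule ≠ ⊥ := fun h => hv (by simpa [h] using hvW)
  refine ⟨W, hW, ?_⟩
  have : Nontrivial W.toSubmodule := Submodule.nontrivial_iff_ne_bot.2 hW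
  have h1 := hgap _ (W.toRepresentation g) (by rw [← map_pow, pow_orderOf_eq_one, map_one])
    ((hρ.toRepresentation W).apply_ne_one hn hg)
  have hdim : (finrank ℂ W.toSubmodule : ℝ) ≤ Fintype.card (Perm (Fin n)) := by
    exact_mod_cast finrank_range_le_card (fun g => ρ g v)
  have h2 : ε / Fintype.card (Perm (Fin n)) * finrank ℂ W.toSubmodule ≤ ε := by
    rw [div_mul_eq_mul_div, div_le_iff₀ hcard]
    exact mul_le_mul_of_nonneg_left hdim hε.le
  linarith

/-- The inclusion of `S_n` in `S_{n+1}` as the stabilizer of the last point. -/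
noncomputable abbrev permCastSucc (n : ℕ) : Perm (Fin n) →* Perm (Fin (n + 1)) :=
  viaEmbeddingHom Fin.castSuccEmb

lemma permCastSucc_castSucc (k : Perm (Fin n)) (i : Fin n) :
    permCastSucc n k i.castSucc = (k i).castSucc :=
  viaEmbedding_apply k Fin.castSuccEmb i

lemma permCastSucc_last (k : Perm (Fin n)) : permCastSucc n k (Fin.last n) = Fin.last n :=
  viaEmbedding_apply_of_notMem k Fin.castSuccEmb _ (by simp)

lemma signChar_permCastSucc (e : ℕ) (k : Perm (Fin n)) :
    signChar (n + 1) e (permCastSucc n k) = signChar n e k := by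
  have h : sign (permCastSucc n k) = sign k := by
    rw [viaEmbeddingHom_apply, viaEmbedding]
    convert sign_extendDomain k _
  rw [signChar_apply, signChar_apply, h]

lemma exists_permCastSucc_eq {h : Perm (Fin (n + 1))} (hh : h (Fin.last n) = Fin.last n) :
    ∃ k, permCastSucc n k = h := by
  have h1 : ∀ i : Fin n, h i.castSucc ≠ Fin.last n := fun i hi =>
    (Fin.castSucc_lt_last i).ne (h.injective (hi.trans hh.symm))
  have h2 : ∀ i : Fin n, h.symm i.castSucc ≠ Fin.last n := fun i hi =>
    (Fin.castSucc_lt_last i).ne (by rw [← hh, ← hi, apply_symm_apply])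
  refine ⟨⟨fun i => (h i.castSucc).castPred (h1 i), fun i => (h.symm i.castSucc).castPred (h2 i),
    fun i => by simp, fun i => by simp⟩, Equiv.ext fun i => ?_⟩
  induction i using Fin.lastCases with
  | last => rw [permCastSucc_last, hh]
  | cast i => rw [permCastSucc_castSucc]; simp

lemma fixCount_eq_trace (g : Perm (Fin n)) :
    LinearMap.trace ℂ (Fin n → ℂ) (LinearMap.funLeft ℂ ℂ (g⁻¹ : Perm (Fin n))) = fixCount g := by
  rw [LinearMap.trace_eq_matrix_trace ℂ (Pi.basisFun ℂ (Fin n)), Matrix.trace, fixCount,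
    Finset.card_filter, Nat.cast_sum]
  refine Finset.sum_congr rfl fun i _ => ?_
  have hi : g.symm i = i ↔ g i = i := by rw [symm_apply_eq, eq_comm]
  simp [LinearMap.funLeft_apply, Pi.single_apply, hi]

/-- The translates of a vector `u` on which the stabilizer `S_n` of the last point acts through a
power of the sign span a twisted standard representation of `S_{n+1}`. -/
lemma exists_standard_subrepresentation [FiniteDimensional ℂ V]
    {ρ : Representation ℂ (Perm (Fin (n + 1))) V} (hρ : LacksSignVectors ρ) {u : V} (hu : u ≠ 0)
    {e : ℕ} (hue : ∀ k, ρ (permCastSucc n k) u = signChar n e k • u) :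
    ∃ W : Subrepresentation ρ, W.toSubmodule ≠ ⊥ ∧ finrank ℂ W.toSubmodule = n ∧
      ∀ g, LinearMap.trace ℂ W.toSubmodule (W.toRepresentation g) =
        signChar (n + 1) e g * (fixCount g - 1) := by
  let χ := signChar (n + 1) e
  have hχ : ∀ g, χ g * χ g = 1 := signChar_mul_self e
  let c : Perm (Fin (n + 1)) → V := fun g => χ g • ρ g u
  have hc : ∀ g h, ρ g (c h) = χ g • c (g * h) := fun g h => by
    simp only [c, map_smul, map_mul, Module.End.mul_apply, smul_smul]
    rw [← mul_assoc, hχ, one_mul]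
  have hc_eq : ∀ g h : Perm (Fin (n + 1)), g (Fin.last n) = h (Fin.last n) → c g = c h := by
    intro g h hgh
    obtain ⟨k, hk⟩ := exists_permCastSucc_eq (h := h⁻¹ * g) (by simp [hgh])
    have hg : g = h * permCastSucc n k := by rw [hk, mul_inv_cancel_left]
    have hχk : χ (permCastSucc n k) = signChar n e k := signChar_permCastSucc e k
    simp only [c, hg, map_mul, Module.End.mul_apply, hue, map_smul, smul_smul, hχk]
    rw [mul_assoc, signChar_mul_self, mul_one]
  let b : Fin (n + 1) → V := fun i => c (swap i (Fin.last n))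
  have hb : ∀ g i, ρ g (b i) = χ g • b (g i) := fun g i => by
    rw [hc]
    congr 1
    exact hc_eq _ _ (by simp)
  have hblast : b (Fin.last n) = u := by
    have h1 : swap (Fin.last n) (Fin.last n) = 1 := swap_self _
    simp only [b, c, h1, map_one, one_smul, Module.End.one_apply]
  let Φ : (Fin (n + 1) → ℂ) →ₗ[ℂ] V := Fintype.linearCombination ℂ b
  have hΦ : ∀ x, Φ x = ∑ i, x i • b i := fun x => Fintype.linearCombination_apply ℂ b x
  let P : Perm (Fin (n + 1)) → (Fin (n + 1) → ℂ) →ₗ[ℂ] (Fin (n + 1) → ℂ) :=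
    fun g => LinearMap.funLeft ℂ ℂ (g⁻¹ : Perm (Fin (n + 1)))
  have hP : ∀ g x i, P g x i = x (g⁻¹ i) := fun g x i => rfl
  have hΦP : ∀ g x, Φ (P g x) = χ g • ρ g (Φ x) := by
    intro g x
    simp only [hΦ, map_sum, map_smul, hb, Finset.smul_sum, hP]
    rw [← Equiv.sum_comp g]
    refine Finset.sum_congr rfl fun i _ => ?_
    rw [show g⁻¹ (g i) = i from g.symm_apply_apply i, smul_comm (χ g) (x i), smul_smul (χ g), hχ,
      one_smul]
  have hρΦ : ∀ g x, ρ g (Φ x) = χ g • Φ (P g x) := fun g x => by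
    rw [hΦP, smul_smul, hχ, one_smul]
  have hone : Φ 1 = 0 := hρ e _ fun g => hρΦ g 1
  have hker : ∀ x, Φ x = 0 → ∀ i j, x i = x j := by
    intro x hx i j
    by_contra hij
    have hne : i ≠ j := fun h => hij (by rw [h])
    have hbij : b i = b j := by
      have h1 : Φ (x - P (swap i j) x) = 0 := by rw [map_sub, hΦP, hx]; simp
      have h2 : x - P (swap i j) x = Pi.single i (x i - x j) + Pi.single j (x j - x i) := by
        ext k
        rcases eq_or_ne k i with rfl | hki
        · simp [hP, hne]
        rcases eq_or_ne k j with rfl | hkj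
        · simp [hP, hki]
        · simp [hP, hki, hkj, swap_apply_of_ne_of_ne]
      rw [h2, map_add] at h1
      simp only [Φ, Fintype.linearCombination_apply_single] at h1
      rw [← neg_sub (x i) (x j), neg_smul, ← sub_eq_add_neg, ← smul_sub] at h1
      exact sub_eq_zero.1 ((smul_eq_zero.1 h1).resolve_left (sub_ne_zero.2 hij))
    have hball : ∀ k, b k = b i := by
      intro k
      rcases eq_or_ne k i with rfl | hki
      · rfl
      rcases eq_or_ne k j with rfl | hkj
      · exact hbij.symm
      have h1 := congrArg (ρ (swap j k)) hbij
      rw [hb, hb, swap_apply_left, swap_apply_of_ne_of_ne hne hki.symm] at h1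
      have h2 := congrArg (fun v => χ (swap j k) • v) h1
      simpa [smul_smul, hχ] using h2.symm
    have h0 : (n + 1 : ℂ) • b i = 0 := by
      rw [← hone, hΦ]
      simp [hball, ← Nat.cast_smul_eq_nsmul ℂ]
    exact hu (by
      rw [← hblast, hball]
      exact (smul_eq_zero.1 h0).resolve_left (Nat.cast_add_one_ne_zero n))
  let K : Submodule ℂ (Fin (n + 1) → ℂ) := LinearMap.ker Φ
  let H : Submodule ℂ (Fin (n + 1) → ℂ) := LinearMap.ker (∑ i, LinearMap.proj (R := ℂ) i)
  have hH : ∀ x, x ∈ H ↔ ∑ i, x i = 0 := fun x => by simp [H]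
  have hKmem : ∀ x, x ∈ K ↔ x = x 0 • 1 := fun x => by
    constructor
    · intro hx
      ext i
      simpa using hker x hx i 0
    · intro hx
      rw [hx, LinearMap.mem_ker, map_smul, hone, smul_zero]
  have hcompl : IsCompl H K := by
    rw [isCompl_iff]
    constructor
    · rw [Submodule.disjoint_def]
      intro x hxH hxK
      rw [hH] at hxH
      rw [hKmem] at hxK
      rw [hxK] at hxH
      have h0 : x 0 = 0 := by
        have h1 : (n + 1 : ℂ) * x 0 = 0 := by simpa using hxH
        exact (mul_eq_zero.1 h1).resolve_left (Nat.cast_add_one_ne_zero n)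
      rw [hxK, h0, zero_smul]
    · rw [Submodule.codisjoint_iff_exists_add_eq]
      intro x
      refine ⟨x - ((∑ i, x i) / (n + 1)) • 1, ((∑ i, x i) / (n + 1)) • 1, ?_, ?_, by simp⟩
      · rw [hH]
        have := Nat.cast_add_one_ne_zero (R := ℂ) n
        simp
        field_simp
        ring
      · rw [hKmem]
        simp
  have hKspan : K = Submodule.span ℂ {1} := by
    ext x
    rw [hKmem, Submodule.mem_span_singleton]
    constructor
    · exact fun h => ⟨x 0, h.symm⟩
    · rintro ⟨a, rfl⟩
      simp
  have hKdim : finrank ℂ K = 1 := by rw [hKspan, finrank_span_singleton one_ne_zero]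
  have hHdim : finrank ℂ H = n := by
    have := Submodule.finrank_add_eq_of_isCompl hcompl
    rw [finrank_fin_fun, hKdim] at this
    omega
  have hPH : ∀ g, ∀ x ∈ H, P g x ∈ H := fun g x hx => by
    rw [hH] at hx ⊢
    rw [← hx]
    exact Equiv.sum_comp (g⁻¹ : Perm (Fin (n + 1))) x
  have hPK' : ∀ g, ∀ x ∈ K, P g x = x := fun g x hx => by
    rw [hKmem] at hx
    rw [hx]
    rfl
  have hPK : ∀ g, ∀ x ∈ K, P g x ∈ K := fun g x hx => by rwa [hPK' g x hx]
  have htrH : ∀ g, LinearMap.trace ℂ H ((P g).restrict (hPH g)) = fixCount g - 1 := fun g => by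
    have h1 := trace_eq_add_of_isCompl hcompl (hPH g) (hPK g)
    have h2 : (P g).restrict (hPK g) = 1 := by
      ext x : 1
      exact Subtype.ext (hPK' g x x.2)
    rw [fixCount_eq_trace, h2, LinearMap.trace_one, hKdim] at h1
    rw [h1]
    simp
  let W : Subrepresentation ρ :=
    { toSubmodule := LinearMap.range Φ
      apply_mem_toSubmodule := by
        rintro g _ ⟨x, rfl⟩
        rw [hρΦ]
        exact Submodule.smul_mem _ _ ⟨_, rfl⟩ }
  let E : H ≃ₗ[ℂ] W.toSubmodule := Φ.kerComplementEquivRange hcompl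
  have hE : ∀ x : H, (E x : V) = Φ x := fun x => rfl
  refine ⟨W, fun h => hu ?_, ?_, fun g => ?_⟩
  · have : u ∈ W.toSubmodule := ⟨Pi.single (Fin.last n) 1, by
      rw [Fintype.linearCombination_apply_single, one_smul, hblast]⟩
    simpa [h] using this
  · rw [← E.finrank_eq, hHdim]
  · have : W.toRepresentation g = χ g • E.conj ((P g).restrict (hPH g)) := by
      ext w
      obtain ⟨x, rfl⟩ := E.surjective w
      have h1 : ((W.toRepresentation g (E x) : W.toSubmodule) : V) = ρ g (Φ x) := rfl
      rw [h1, hρΦ]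
      simp [LinearEquiv.conj_apply, hE]
    rw [this, map_smul, LinearMap.trace_conj', htrH, smul_eq_mul]

/-- A trace bound for `g ∈ S_n` passes to the image of `g` in `S_{n+1}`, as soon as it holds for
the standard representation of `S_{n+1}`. -/
lemma trace_re_le_permCastSucc {g : Perm (Fin n)} {c : ℝ}
    (hg : 1 ≤ fixCount (permCastSucc n g)) (hstd : (fixCount (permCastSucc n g) : ℝ) - 1 ≤ c * n)
    (H : ∀ (V : Type) [AddCommGroup V] [Module ℂ V] [FiniteDimensional ℂ V]
      (ρ : Representation ℂ (Perm (Fin n)) V), LacksSignVectors ρ →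
      (LinearMap.trace ℂ V (ρ g)).re ≤ c * finrank ℂ V)
    (V : Type) [AddCommGroup V] [Module ℂ V] [FiniteDimensional ℂ V]
    (ρ : Representation ℂ (Perm (Fin (n + 1))) V) (hρ : LacksSignVectors ρ) :
    (LinearMap.trace ℂ V (ρ (permCastSucc n g))).re ≤ c * finrank ℂ V := by
  refine trace_re_le_of_exists_subrepresentation _ c (fun V _ _ _ _ ρ hρ => ?_) V ρ hρ
  let ρ' : Representation ℂ (Perm (Fin n)) V := ρ.comp (permCastSucc n)
  by_cases h : LacksSignVectors ρ'
  · exact ⟨⊤, top_ne_bot, H _ (⊤ : Subrepresentation ρ').toRepresentation (h.toRepresentation ⊤)⟩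
  · simp only [LacksSignVectors, not_forall] at h
    obtain ⟨e, u, hue, hu⟩ := h
    obtain ⟨W, hW, hdim, htr⟩ := exists_standard_subrepresentation hρ hu hue
    refine ⟨W, hW, ?_⟩
    rw [htr, hdim]
    refine le_trans ?_ hstd
    have h1 : (1 : ℝ) ≤ fixCount (permCastSucc n g) := by exact_mod_cast hg
    rcases signChar_eq_one_or e (permCastSucc n g) with h | h
    · simp [h]
    · simp [h]
      linarith

lemma fixCount_add_card_support (g : Perm (Fin n)) : fixCount g + g.support.card = n := by
  rw [fixCount, Perm.support, Finset.card_filter_add_card_filter_not, Finset.card_univ,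
    Fintype.card_fin]

lemma fixCount_viaEmbedding {r : ℕ} (σ : Perm (Fin r)) (ι : Fin r ↪ Fin n) :
    (fixCount (σ.viaEmbedding ι) : ℝ) = n - r + fixCount σ := by
  have h : (σ.viaEmbedding ι).support.card = σ.support.card := by
    rw [viaEmbedding]
    convert! card_support_extend_domain _
  have h1 := fixCount_add_card_support (σ.viaEmbedding ι)
  have h2 := fixCount_add_card_support σ
  rw [h] at h1
  have h3 : (fixCount (σ.viaEmbedding ι) : ℝ) + σ.support.card = n := by exact_mod_cast h1
  have h4 : (fixCount σ : ℝ) + σ.support.card = r := by exact_mod_cast h2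
  linarith

lemma viaEmbedding_castLEEmb_succ {r : ℕ} (σ : Perm (Fin r)) (h : r ≤ n) :
    σ.viaEmbedding (Fin.castLEEmb (h.trans n.le_succ)) =
      permCastSucc n (σ.viaEmbedding (Fin.castLEEmb h)) := by
  have hcomp : ∀ j, Fin.castLEEmb (h.trans n.le_succ) j = (Fin.castLEEmb h j).castSucc :=
    fun j => rfl
  ext i : 1
  induction i using Fin.lastCases with
  | last =>
    rw [permCastSucc_last, viaEmbedding_apply_of_notMem]
    rintro ⟨j, hj⟩
    rw [hcomp] at hj
    exact (Fin.castSucc_lt_last _).ne hj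
  | cast i =>
    rw [permCastSucc_castSucc]
    by_cases hi : i ∈ Set.range (Fin.castLEEmb h)
    · obtain ⟨j, rfl⟩ := hi
      rw [viaEmbedding_apply, ← hcomp, viaEmbedding_apply, hcomp]
    · rw [viaEmbedding_apply_of_notMem _ _ _ hi, viaEmbedding_apply_of_notMem]
      rintro ⟨j, hj⟩
      rw [hcomp] at hj
      exact hi ⟨j, Fin.castSucc_injective _ hj⟩

lemma IsNontrivIrr.lacksSignVectors {V : FDRep ℂ (Perm (Fin n))} (hV : IsNontrivIrr V) :
    LacksSignVectors V.ρ := by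
  obtain ⟨hsimple, htriv, hsgn⟩ := hV
  intro e v hv
  by_contra hv0
  let ψ : Representation ℂ (Perm (Fin n)) ℂ :=
    ((Algebra.lmul ℂ ℂ : ℂ →ₐ[ℂ] End ℂ ℂ) : ℂ →* End ℂ ℂ).comp (signChar n e)
  let f : FDRep.of ψ ⟶ V :=
    { hom := FGModuleCat.ofHom (LinearMap.toSpanSingleton ℂ V v)
      comm := fun g => by
        ext
        change (signChar n e g * (1 : ℂ)) • v = V.ρ g ((1 : ℂ) • v)
        rw [mul_one, one_smul, hv] }
  have hf : ∀ z : ℂ, f.hom z = z • v := fun z => rfl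
  have hmono : Mono f := by
    refine ConcreteCategory.mono_of_injective f fun a b hab => ?_
    exact smul_left_injective ℂ hv0 hab
  have hf0 : f ≠ 0 := fun h => hv0 (by
    have := hf 1
    rw [h, one_smul] at this
    exact this.symm)
  have := isIso_of_mono_of_nonzero hf0
  have hchar : V.character = signChar n e := by
    rw [← FDRep.char_iso (asIso f)]
    ext g
    change LinearMap.trace ℂ ℂ (Algebra.lmul ℂ ℂ (signChar n e g)) = _
    simp [LinearMap.trace_eq_matrix_trace ℂ (Basis.singleton Unit ℂ), Matrix.trace,
      LinearMap.toMatrix_apply]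
  rcases Nat.even_or_odd e with he | he
  · refine htriv (hchar.trans (funext fun g => ?_))
    rcases Int.units_eq_one_or (sign g) with h | h <;> simp [signChar_apply, h, he.neg_one_pow]
  · refine hsgn (hchar.trans (funext fun g => ?_))
    rcases Int.units_eq_one_or (sign g) with h | h <;> simp [signChar_apply, h, he.neg_one_pow]

/-- Beyond some point, normalized traces at the stable image of `σ ≠ 1` are bounded by either a
constant less than `1` or the value for the standard representation. -/
lemma exists_stable_trace_bound {r : ℕ} {σ : Perm (Fin r)} (hσ : σ ≠ 1) :
    ∃ δ : ℝ, 0 < δ ∧ ∀ n, r + 5 ≤ n → ∀ h : r ≤ n,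
      ∀ (V : Type) [AddCommGroup V] [Module ℂ V] [FiniteDimensional ℂ V]
      (ρ : Representation ℂ (Perm (Fin n)) V), LacksSignVectors ρ →
      (LinearMap.trace ℂ V (ρ (σ.viaEmbedding (Fin.castLEEmb h)))).re ≤
        (1 - min δ (((r : ℝ) - fixCount σ) / (n - 1))) * finrank ℂ V := by
  have hne : σ.viaEmbedding (Fin.castLEEmb (Nat.le_add_right r 5)) ≠ 1 := fun h =>
    hσ (viaEmbeddingHom_injective (Fin.castLEEmb (Nat.le_add_right r 5)) (by
      rw [viaEmbeddingHom_apply, h, map_one]))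
  obtain ⟨δ, hδ, hbound⟩ := exists_uniform_trace_gap (Nat.le_add_left 5 r) hne
  refine ⟨δ, hδ, fun n hn => ?_⟩
  have hk : (0 : ℝ) ≤ r - fixCount σ := by
    have := fixCount_add_card_support σ
    rw [sub_nonneg]
    exact_mod_cast (by omega : fixCount σ ≤ r)
  induction n, hn using Nat.le_induction with
  | base =>
    intro h V _ _ _ ρ hρ
    refine (hbound V ρ hρ).trans (mul_le_mul_of_nonneg_right ?_ (Nat.cast_nonneg _))
    linarith [min_le_left δ (((r : ℝ) - fixCount σ) / ((r + 5 : ℕ) - 1))]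
  | succ n hn ih =>
    intro h
    have hrn : r ≤ n := by omega
    have hn5 : (r : ℝ) + 5 ≤ n := by exact_mod_cast hn
    have hr0 : (0 : ℝ) ≤ r := Nat.cast_nonneg r
    rw [viaEmbedding_castLEEmb_succ σ hrn]
    have hfix := fixCount_viaEmbedding σ (Fin.castLEEmb (hrn.trans n.le_succ))
    rw [viaEmbedding_castLEEmb_succ σ hrn] at hfix
    push_cast at hfix ⊢
    rw [add_sub_cancel_right]
    refine trace_re_le_permCastSucc ?_ ?_ fun V _ _ _ ρ hρ => ?_
    · have : (1 : ℝ) ≤ fixCount (permCastSucc n (σ.viaEmbedding (Fin.castLEEmb hrn))) := by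
        rw [hfix]
        have : (0 : ℝ) ≤ fixCount σ := Nat.cast_nonneg _
        linarith
      exact_mod_cast this
    · rw [hfix]
      have hn0 : (0 : ℝ) < n := by linarith
      have h1 : min δ (((r : ℝ) - fixCount σ) / n) * n ≤ r - fixCount σ := by
        rw [← le_div_iff₀ hn0]
        exact min_le_right _ _
      linarith
    · refine (ih hrn V ρ hρ).trans (mul_le_mul_of_nonneg_right ?_ (Nat.cast_nonneg _))
      have h1 : ((r : ℝ) - fixCount σ) / n ≤ (r - fixCount σ) / (n - 1) :=
        div_le_div_of_nonneg_left hk (by linarith) (by linarith)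
      linarith [min_le_min_left δ h1]

end Representations

/-- **Lemma (std rules eventually).** Fix `r` and `σ ∈ S_r`, and for `n ≥ r` let
`σ_n ∈ S_n` act as `σ` on `{1,…,r}` and fix the remaining points. Then for every large
enough `n`, the standard representation rules for `σ_n` in `S_n`: for every irreducible
character `χ ∉ {triv, sgn}`, `χ̃(σ_n) ≤ (c₁(σ_n)-1)/(n-1) = (n - r + c₁(σ) - 1)/(n-1)`. -/
theorem std_rules_eventually (r : ℕ) (σ : Equiv.Perm (Fin r)) :
    ∃ n₀ : ℕ, ∃ hr : r ≤ n₀, ∀ n : ℕ, ∀ hn : n₀ ≤ n,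
      ∀ V : FDRep ℂ (Equiv.Perm (Fin n)), IsNontrivIrr V →
        normChar V (σ.viaEmbedding (Fin.castLEEmb (hr.trans hn))) ≤
          ((n : ℝ) - (r : ℝ) + (fixCount σ : ℝ) - 1) / ((n : ℝ) - 1) := by
  have hk : (fixCount σ : ℝ) ≤ r := by
    have := fixCount_add_card_support σ
    exact_mod_cast (by omega : fixCount σ ≤ r)
  have hc0 : (0 : ℝ) ≤ fixCount σ := Nat.cast_nonneg _
  rcases eq_or_ne σ 1 with rfl | hσ
  · refine ⟨r + 2, Nat.le_add_right r 2, fun n hn V _ => ?_⟩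
    have h1 : (1 : Equiv.Perm (Fin r)).viaEmbedding
        (Fin.castLEEmb ((Nat.le_add_right r 2).trans hn)) = 1 :=
      map_one (Equiv.Perm.viaEmbeddingHom _)
    have h2 : fixCount (1 : Equiv.Perm (Fin r)) = r := by simp [fixCount]
    have hn' : (r : ℝ) + 2 ≤ n := by exact_mod_cast hn
    have hr0 : (0 : ℝ) ≤ r := Nat.cast_nonneg r
    rw [h1, h2, sub_add_cancel, div_self (by linarith), normChar]
    rcases eq_or_ne (V.character 1) 0 with h | h
    · rw [h, div_zero, Complex.zero_re]
      exact zero_le_one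
    · rw [div_self h, Complex.one_re]
  · obtain ⟨δ, hδ, hbound⟩ := exists_stable_trace_bound hσ
    obtain ⟨N, hN⟩ := exists_nat_ge (((r : ℝ) - fixCount σ) / δ)
    refine ⟨r + 5 + N, by omega, fun n hn V hV => ?_⟩
    have hn' : (r : ℝ) + 5 + N ≤ n := by exact_mod_cast hn
    have hr0 : (0 : ℝ) ≤ r := Nat.cast_nonneg r
    have hN0 : (0 : ℝ) ≤ N := Nat.cast_nonneg N
    have hn1 : (0 : ℝ) < n - 1 := by linarith
    have hmin : ((r : ℝ) - fixCount σ) / (n - 1) ≤ δ := by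
      rw [div_le_iff₀ hδ] at hN
      rw [div_le_iff₀ hn1]
      nlinarith
    have h1 := hbound n (by omega) (by omega) V V.ρ hV.lacksSignVectors
    rw [min_eq_right hmin] at h1
    have h2 : (1 : ℝ) - (r - fixCount σ) / (n - 1) = (n - r + fixCount σ - 1) / (n - 1) := by
      field_simp
      ring
    rw [h2] at h1
    rw [normChar, FDRep.char_one, Complex.div_natCast_re]
    refine div_le_of_le_mul₀ (Nat.cast_nonneg _) (div_nonneg ?_ hn1.le) h1
    linarith
end

section
/- For every constant M ∈ ℕ there exists N₄ = N₄(M) ∈ ℕ such that for every n ≥ N₄ and every σ ∈ S_n with |supp(σ)| ≤ M, the standard representation rules for σ in S_n: for every irreducible complex character χ of S_n other than the trivial and sign characters, χ̃(σ) ≤ (c₁(σ)-1)/(n-1). -/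
open CategoryTheory

open Equiv Module

section LinearConstituents

variable {α V : Type*} [Fintype α] [DecidableEq α] [AddCommGroup V] [Module ℂ V]

/-- A representation of a symmetric group without trivial or sign constituent. -/
def NoLinearConstituent (ρ : Representation ℂ (Perm α) V) : Prop :=
  (∀ v, (∀ g, ρ g v = v) → v = 0) ∧
    ∀ v, (∀ g, ρ g v = ((Perm.sign g : ℤ) : ℂ) • v) → v = 0

/-- A simple `FDRep` with a nonzero vector on which the group acts through a linear character
has that linear character as its character. -/
theorem FDRep.character_eq_of_eigenvector {G : Type} [Group G] (V : FDRep ℂ G) [Simple V]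
    (χ : G →* ℂ) (v : V) (hv : v ≠ 0) (h : ∀ g, V.ρ g v = χ g • v) : V.character = χ := by
  let τ : Representation ℂ G ℂ := (Algebra.lmul ℂ ℂ : ℂ →* (ℂ →ₗ[ℂ] ℂ)).comp χ
  let f : FDRep.of τ ⟶ V :=
    ⟨InducedCategory.homMk (ModuleCat.ofHom (LinearMap.toSpanSingleton ℂ V v)), fun g ↦ by
    ext
    change (χ g * 1 : ℂ) • v = V.ρ g ((1 : ℂ) • v)
    simp [h]⟩
  have hf : Mono f := by
    have : Mono (InducedCategory.homMk (ModuleCat.ofHom (LinearMap.toSpanSingleton ℂ V v)) :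
        FGModuleCat.of ℂ ℂ ⟶ V.V) := by
      apply (forget (FGModuleCat ℂ)).mono_of_mono_map
      rw [mono_iff_injective]
      exact smul_left_injective ℂ hv
    exact (Action.forget _ _).mono_of_mono_map this
  have hf0 : f ≠ 0 := by
    intro h0
    have : (f.hom.hom.hom (1 : ℂ) : V) = 0 := by rw [h0]; rfl
    apply hv
    change (1 : ℂ) • v = 0 at this
    simpa using this
  have := isIso_of_mono_of_nonzero hf0
  rw [← FDRep.char_iso (asIso f)]
  ext g
  change LinearMap.trace ℂ ℂ (Algebra.lmul ℂ ℂ (χ g)) = χ g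
  rw [show (Algebra.lmul ℂ ℂ (χ g)) = χ g • (1 : ℂ →ₗ[ℂ] ℂ) by ext; simp]
  simp

theorem IsNontrivIrr.noLinearConstituent {n : ℕ} {V : FDRep ℂ (Perm (Fin n))}
    (hV : IsNontrivIrr V) : NoLinearConstituent V.ρ := by
  obtain ⟨hs, h1, h2⟩ := hV
  refine ⟨fun v hv ↦ ?_, fun v hv ↦ ?_⟩ <;> by_contra hv0
  · apply h1
    rw [FDRep.character_eq_of_eigenvector V 1 v hv0 (by simpa using hv)]
    rfl
  · apply h2
    rw [FDRep.character_eq_of_eigenvector V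
      ((Int.castRingHom ℂ : ℤ →* ℂ).comp ((Units.coeHom ℤ).comp Perm.sign)) v hv0 hv]
    rfl

/-- Every permutation moving some point and fixing another has the alternating group in its
normal closure. -/
theorem alternatingGroup_le_normalClosure {σ : Perm α} {x z : α} (hx : σ x ≠ x) (hz : σ z = z) :
    alternatingGroup α ≤ Subgroup.normalClosure {σ} := by
  have hxz : x ≠ z := fun h ↦ hx (h ▸ hz)
  have hyz : σ x ≠ z := fun h ↦ hxz (σ.injective (h.trans hz.symm))
  have h3 : (swap z (σ x) * swap z x).IsThreeCycle :=
    Perm.isThreeCycle_swap_mul_swap_same hyz.symm hxz.symm hx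
  have hσ : σ ∈ Subgroup.normalClosure {σ} := Subgroup.subset_normalClosure rfl
  have hmem : swap z (σ x) * swap z x ∈ Subgroup.normalClosure {σ} := by
    have : swap z (σ x) * swap z x = σ * (swap z x * σ⁻¹ * (swap z x)⁻¹) := by
      rw [swap_inv, ← mul_assoc, ← mul_assoc, Equiv.mul_swap_eq_swap_mul σ, hz,
        mul_inv_cancel_right]
    rw [this]
    exact mul_mem hσ (Subgroup.normalClosure_normal.conj_mem _ (inv_mem hσ) _)
  rw [← Perm.closure_three_cycles_eq_alternating, Subgroup.closure_le]
  intro g hg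
  obtain ⟨c, rfl⟩ := isConj_iff.1 ((Perm.isConj_iff_cycleType_eq).2
    (h3.cycleType.trans (Perm.IsThreeCycle.cycleType hg).symm))
  exact Subgroup.normalClosure_normal.conj_mem _ hmem _

theorem NoLinearConstituent.eq_zero_of_forall_conj_fixed {ρ : Representation ℂ (Perm α) V}
    (hρ : NoLinearConstituent ρ) {σ : Perm α} {x z : α} (hx : σ x ≠ x) (hz : σ z = z) {v : V}
    (hv : ∀ g, ρ (g * σ * g⁻¹) v = v) : v = 0 := by
  have hA : ∀ g : Perm α, Perm.sign g = 1 → ρ g v = v := by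
    let H : Subgroup (Perm α) :=
      { carrier := {g | ρ g v = v}
        one_mem' := by simp
        mul_mem' := fun {a b} ha hb ↦ by
          simp only [Set.mem_ofPred_eq] at ha hb ⊢
          rw [map_mul, Module.End.mul_apply, hb, ha]
        inv_mem' := fun {a} ha ↦ by
          simp only [Set.mem_ofPred_eq] at ha ⊢
          conv_lhs => rw [← ha]
          rw [← Module.End.mul_apply, ← map_mul]
          simp }
    have hH : Subgroup.normalClosure {σ} ≤ H := by
      rw [Subgroup.normalClosure, Subgroup.closure_le]
      intro g hg
      obtain ⟨_, rfl, hc⟩ := Group.mem_conjugatesOfSet_iff.1 hg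
      obtain ⟨c, rfl⟩ := isConj_iff.1 hc
      exact hv c
    intro g hg
    exact hH (alternatingGroup_le_normalClosure hx hz (Perm.mem_alternatingGroup.2 hg))
  set τ := swap x (σ x) with hτ
  have hsτ : Perm.sign τ = -1 := Perm.sign_swap (Ne.symm hx)
  have hττ : τ * τ = 1 := by simp [hτ]
  have key : ∀ g, (ρ g v = v ∧ ρ g (ρ τ v) = ρ τ v ∧ Perm.sign g = 1) ∨
      (ρ g v = ρ τ v ∧ ρ g (ρ τ v) = v ∧ Perm.sign g = -1) := by
    intro g
    rcases Int.units_eq_one_or (Perm.sign g) with hg | hg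
    · refine Or.inl ⟨hA g hg, ?_, hg⟩
      have := congrArg (ρ τ) (hA (τ * g * τ) (by simp [hsτ, hg]))
      rwa [← Module.End.mul_apply, ← map_mul, show τ * (τ * g * τ) = g * τ by
        rw [← mul_assoc, ← mul_assoc, hττ, one_mul], map_mul, Module.End.mul_apply] at this
    · refine Or.inr ⟨?_, ?_, hg⟩
      · have := congrArg (ρ τ) (hA (τ * g) (by simp [hsτ, hg]))
        rwa [← Module.End.mul_apply, ← map_mul, ← mul_assoc, hττ, one_mul] at this
      · rw [← Module.End.mul_apply, ← map_mul]
        exact hA _ (by simp [hsτ, hg])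
  have h1 : v + ρ τ v = 0 := hρ.1 _ fun g ↦ by
    rcases key g with ⟨h, h', -⟩ | ⟨h, h', -⟩ <;> rw [map_add, h, h']
    exact add_comm _ _
  have h2 : v - ρ τ v = 0 := hρ.2 _ fun g ↦ by
    rcases key g with ⟨h, h', hs⟩ | ⟨h, h', hs⟩ <;> rw [map_sub, h, h', hs] <;> simp
  have : (2 : ℂ) • v = 0 := by
    rw [two_smul]
    calc v + v = (v + ρ τ v) + (v - ρ τ v) := by abel
      _ = 0 := by rw [h1, h2, add_zero]
  simpa using this

end LinearConstituents

/-- The real parts of the nontrivial `k`-th roots of unity are bounded away from `1`. -/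
theorem exists_re_le_of_pow_eq_one (k : ℕ) (hk : 0 < k) :
    ∃ ε : ℝ, 0 < ε ∧ ∀ μ : ℂ, μ ^ k = 1 → μ ≠ 1 → μ.re ≤ 1 - ε := by
  classical
  have hlt : ∀ μ : ℂ, μ ^ k = 1 → μ ≠ 1 → μ.re < 1 := by
    intro μ hμ hne
    have hn : ‖μ‖ = 1 := Complex.norm_eq_one_of_pow_eq_one hμ hk.ne'
    refine lt_of_le_of_ne (hn ▸ Complex.re_le_norm μ) fun hre ↦ hne ?_
    have h2 := Complex.sq_norm μ
    rw [hn, Complex.normSq_apply, hre] at h2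
    apply Complex.ext hre
    simpa using h2
  let S : Finset ℂ := ((Polynomial.nthRoots k (1 : ℂ)).toFinset).erase 1
  have hS : ∀ μ : ℂ, μ ∈ S ↔ μ ≠ 1 ∧ μ ^ k = 1 := by
    simp [S, Polynomial.mem_nthRoots hk]
  rcases S.eq_empty_or_nonempty with h | h
  · refine ⟨1, one_pos, fun μ h1 h2 ↦ ?_⟩
    exact absurd ((hS μ).2 ⟨h2, h1⟩) (by simp [h])
  · obtain ⟨ν, hν, hmax⟩ := S.exists_max_image Complex.re h
    obtain ⟨h1, h2⟩ := (hS ν).1 hν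
    refine ⟨1 - ν.re, sub_pos.2 (hlt ν h2 h1),
      fun μ h3 h4 ↦ ?_⟩
    have := hmax μ ((hS μ).2 ⟨h4, h3⟩)
    linarith

section Trace

variable {V : Type*} [AddCommGroup V] [Module ℂ V] [FiniteDimensional ℂ V]

theorem re_trace_le_of_pow_eq_one {k : ℕ} (hk : 0 < k) {ε : ℝ}
    (hε : ∀ μ : ℂ, μ ^ k = 1 → μ ≠ 1 → μ.re ≤ 1 - ε) (f : Module.End ℂ V) (hf : f ^ k = 1) :
    (LinearMap.trace ℂ V f).re ≤ finrank ℂ V - ε * finrank ℂ (LinearMap.range (f - 1)) := by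
  classical
  have hss : f.IsSemisimple := by
    refine Module.End.isSemisimple_of_squarefree_aeval_eq_zero
      (p := Polynomial.X ^ k - 1) ?_ (by simp [hf])
    have : ((k : ℕ) : ℂ) ≠ 0 := by exact_mod_cast hk.ne'
    exact (Polynomial.separable_X_pow_sub_C (1 : ℂ) this one_ne_zero).squarefree
  have htop : ⨆ μ, f.eigenspace μ = ⊤ := by
    rw [← Module.End.iSup_maxGenEigenspace_eq_top f]
    simp_rw [hss.isFinitelySemisimple.maxGenEigenspace_eq_eigenspace]
  have hint : DirectSum.IsInternal f.eigenspace :=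
    DirectSum.isInternal_submodule_of_iSupIndep_of_iSup_eq_top f.eigenspaces_iSupIndep htop
  have hfin : {μ | f.eigenspace μ ≠ ⊥}.Finite :=
    WellFoundedGT.finite_ne_bot_of_iSupIndep f.eigenspaces_iSupIndep
  have hmaps : ∀ μ, Set.MapsTo f (f.eigenspace μ) (f.eigenspace μ) := fun μ v hv ↦ by
    rw [SetLike.mem_coe, Module.End.mem_eigenspace_iff] at hv ⊢
    rw [hv, map_smul, hv]
  have htr : LinearMap.trace ℂ V f = ∑ μ ∈ hfin.toFinset, μ * finrank ℂ (f.eigenspace μ) := by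
    rw [LinearMap.trace_eq_sum_trace_restrict' hint hfin hmaps]
    refine Finset.sum_congr rfl fun μ _ ↦ ?_
    have : f.restrict (hmaps μ) = μ • (LinearMap.id : f.eigenspace μ →ₗ[ℂ] f.eigenspace μ) := by
      ext v
      exact Module.End.mem_eigenspace_iff.1 v.2
    rw [this, map_smul, LinearMap.trace_id, smul_eq_mul]
  have hdim : (finrank ℂ V : ℝ) = ∑ μ ∈ hfin.toFinset, (finrank ℂ (f.eigenspace μ) : ℝ) := by
    have h := LinearMap.trace_eq_sum_trace_restrict' hint hfin (f := LinearMap.id)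
      (fun μ v hv ↦ hv)
    simp only [LinearMap.trace_id] at h
    have h' : (finrank ℂ V : ℂ) = ∑ μ ∈ hfin.toFinset, (finrank ℂ (f.eigenspace μ) : ℂ) := by
      rw [h]
      refine Finset.sum_congr rfl fun μ _ ↦ ?_
      rw [← LinearMap.trace_id]
      rfl
    exact_mod_cast h'
  have hroot : ∀ μ ∈ hfin.toFinset, μ ^ k = 1 := by
    intro μ hμ
    obtain ⟨v, hv, hv0⟩ := Submodule.exists_mem_ne_zero_of_ne_bot (hfin.mem_toFinset.1 hμ)
    have hpow : ∀ j, (f ^ j) v = μ ^ j • v := by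
      intro j
      induction j with
      | zero => simp
      | succ j ih =>
        rw [pow_succ', Module.End.mul_apply, ih, map_smul, Module.End.mem_eigenspace_iff.1 hv,
          smul_smul, pow_succ]
    have := hpow k
    rw [hf, Module.End.one_apply] at this
    exact (smul_left_injective ℂ hv0 (by simpa using this.symm))
  have hrank : (finrank ℂ (LinearMap.range (f - 1)) : ℝ) =
      finrank ℂ V - finrank ℂ (f.eigenspace 1) := by
    have h1 := LinearMap.finrank_range_add_finrank_ker (f - 1)
    have h2 : f.eigenspace 1 = LinearMap.ker (f - 1) := by
      rw [Module.End.eigenspace_def]; simp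
    rw [h2, ← h1]; push_cast; ring
  have hsum : ∑ μ ∈ hfin.toFinset, (if μ = 1 then (finrank ℂ (f.eigenspace μ) : ℝ) else 0) =
      finrank ℂ (f.eigenspace 1) := by
    rw [Finset.sum_ite_eq']
    split_ifs with h
    · rfl
    · have : f.eigenspace 1 = ⊥ := by simpa using h
      rw [this]; simp
  rw [hrank, ← hsum, hdim, ← Finset.sum_sub_distrib, Finset.mul_sum, ← Finset.sum_sub_distrib,
    htr, Complex.re_sum]
  refine Finset.sum_le_sum fun μ hμ ↦ ?_
  have hre : (μ * (finrank ℂ (f.eigenspace μ) : ℂ)).re = μ.re * finrank ℂ (f.eigenspace μ) := by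
    simp
  rw [hre]
  have h0 : (0 : ℝ) ≤ finrank ℂ (f.eigenspace μ) := Nat.cast_nonneg _
  split_ifs with h
  · simp [h]
  · have := hε μ (hroot μ hμ) h
    nlinarith

end Trace

section Gap

variable {α V : Type*} [Fintype α] [DecidableEq α] [AddCommGroup V] [Module ℂ V]
  [FiniteDimensional ℂ V]

theorem NoLinearConstituent.finrank_le {ρ : Representation ℂ (Perm α) V}
    (hρ : NoLinearConstituent ρ) {σ : Perm α} {x z : α} (hx : σ x ≠ x) (hz : σ z = z) :
    finrank ℂ V ≤ (Fintype.card α).factorial * finrank ℂ (LinearMap.range (ρ σ - 1)) := by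
  let Φ : V →ₗ[ℂ] (Perm α → LinearMap.range (ρ σ - 1)) :=
    LinearMap.pi fun g ↦ (ρ σ - 1).rangeRestrict ∘ₗ ρ g⁻¹
  have hΦ : Function.Injective Φ := by
    rw [injective_iff_map_eq_zero]
    intro v hv
    refine hρ.eq_zero_of_forall_conj_fixed hx hz fun g ↦ ?_
    have h1 : ρ σ (ρ g⁻¹ v) - ρ g⁻¹ v = 0 := congrArg Subtype.val (congrFun hv g)
    rw [map_mul, map_mul, Module.End.mul_apply, Module.End.mul_apply, sub_eq_zero.1 h1,
      ← Module.End.mul_apply, ← map_mul, mul_inv_cancel, map_one, Module.End.one_apply]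
  have := LinearMap.finrank_le_finrank_of_injective hΦ
  rwa [Module.finrank_pi_fintype, Finset.sum_const, Finset.card_univ, Fintype.card_perm,
    smul_eq_mul] at this

end Gap

/-- `c` bounds the normalized character at `σ` of every representation without trivial or sign
constituent. -/
def BoundsNormChar {α : Type} [Fintype α] [DecidableEq α] (σ : Perm α) (c : ℝ) : Prop :=
  ∀ (V : Type) [AddCommGroup V] [Module ℂ V] [FiniteDimensional ℂ V]
    (ρ : Representation ℂ (Perm α) V), NoLinearConstituent ρ →
      (LinearMap.trace ℂ V (ρ σ)).re ≤ c * finrank ℂ V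

/-- A uniform character gap for permutations moving some point and fixing another. -/
theorem exists_boundsNormChar (m : ℕ) :
    ∃ c : ℝ, c < 1 ∧ ∀ (α : Type) [Fintype α] [DecidableEq α], Fintype.card α = m →
      ∀ (σ : Perm α) (x z : α), σ x ≠ x → σ z = z → BoundsNormChar σ c := by
  obtain ⟨ε, hε, h⟩ := exists_re_le_of_pow_eq_one m.factorial m.factorial_pos
  refine ⟨1 - ε / m.factorial, by simp [hε, m.factorial_pos], ?_⟩
  rintro α _ _ rfl σ x z hx hz V _ _ _ ρ hρ
  have hpow : ρ σ ^ (Fintype.card α).factorial = 1 := by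
    rw [← map_pow, ← Fintype.card_perm, pow_card_eq_one, map_one]
  have h1 := re_trace_le_of_pow_eq_one (Nat.factorial_pos _) h (ρ σ) hpow
  have h2 : (finrank ℂ V : ℝ) ≤
      (Fintype.card α).factorial * finrank ℂ (LinearMap.range (ρ σ - 1)) := by
    exact_mod_cast hρ.finrank_le hx hz
  have hpos : (0 : ℝ) < (Fintype.card α).factorial := by
    exact_mod_cast Nat.factorial_pos _
  have h3 : ε / (Fintype.card α).factorial * finrank ℂ V ≤
      ε * finrank ℂ (LinearMap.range (ρ σ - 1)) := by
    rw [div_mul_eq_mul_div, div_le_iff₀ hpos]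
    nlinarith
  linarith

section Decomposition

variable {V : Type*} [AddCommGroup V] [Module ℂ V]

theorem trace_eq_add_of_isCompl_s10 [FiniteDimensional ℂ V] {W W' : Submodule ℂ V} (hW : IsCompl W W')
    (f : Module.End ℂ V) (h : ∀ v ∈ W, f v ∈ W) (h' : ∀ v ∈ W', f v ∈ W') :
    LinearMap.trace ℂ V f =
      LinearMap.trace ℂ W (f.restrict h) + LinearMap.trace ℂ W' (f.restrict h') := by
  rw [← LinearMap.trace_prodMap', ← LinearMap.trace_conj' _ (W.prodEquivOfIsCompl W' hW)]
  congr 1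
  ext v
  obtain ⟨⟨a, b⟩, rfl⟩ := (W.prodEquivOfIsCompl W' hW).surjective v
  simp [LinearEquiv.conj_apply_apply]

theorem NoLinearConstituent.subrepresentation {α : Type*} [Fintype α] [DecidableEq α]
    {ρ : Representation ℂ (Perm α) V} (hρ : NoLinearConstituent ρ) (W : Subrepresentation ρ) :
    NoLinearConstituent W.toRepresentation := by
  refine ⟨fun v hv ↦ Subtype.ext (hρ.1 v fun g ↦ ?_), fun v hv ↦ Subtype.ext (hρ.2 v fun g ↦ ?_)⟩
  · exact congrArg Subtype.val (hv g)
  · exact congrArg Subtype.val (hv g)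

end Decomposition

section Standard

variable {α V : Type*} [Fintype α] [DecidableEq α] [AddCommGroup V] [Module ℂ V]

/-- A representation without invariants that has a nonzero vector fixed by a point stabilizer
contains the standard representation. -/
theorem exists_standard_subrepresentation_s10 {ρ : Representation ℂ (Perm α) V}
    (hρ : ∀ v, (∀ g, ρ g v = v) → v = 0) (x : α) {u : V} (hu0 : u ≠ 0)
    (hu : ∀ g : Perm α, g x = x → ρ g u = u) :
    ∃ (W : Submodule ℂ V) (h : ∀ g, ∀ v ∈ W, ρ g v ∈ W),
      finrank ℂ W + 1 = Fintype.card α ∧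
      ∀ σ : Perm α, LinearMap.trace ℂ W ((ρ σ).restrict (h σ)) + 1 =
        (Finset.univ.filter fun a ↦ σ a = a).card := by
  let w : α → V := fun a ↦ ρ (swap x a) u
  have hw : ∀ g a, ρ g (w a) = w (g a) := by
    intro g a
    have := hu (swap x (g a) * g * swap x a) (by simp)
    have h2 := congrArg (ρ (swap x (g a))) this
    rwa [← Module.End.mul_apply, ← map_mul, ← mul_assoc, ← mul_assoc, swap_mul_self, one_mul,
      map_mul, Module.End.mul_apply] at h2
  have hwx : w x = u := hu _ (by simp)
  have hne : ∀ a b, a ≠ b → w a ≠ w b := by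
    intro a b hab h
    have hall : ∀ c, w c = w a := by
      intro c
      by_cases hc : c = a
      · rw [hc]
      by_cases hc' : c = b
      · rw [hc', h]
      have := congrArg (ρ (swap b c)) h
      rw [hw, hw, swap_apply_of_ne_of_ne hab (Ne.symm hc), swap_apply_left] at this
      exact this.symm
    apply hu0
    rw [← hwx]
    exact hρ _ fun g ↦ by rw [hw, hall, hall x]
  have hsum : ∑ a, w a = 0 := hρ _ fun g ↦ by
    rw [map_sum]
    simp_rw [hw]
    exact Equiv.sum_comp g w
  have hconst : ∀ c : α → ℂ, ∑ a, c a • w a = 0 → ∀ a b, c a = c b := by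
    intro c hc a b
    by_contra hab
    have hab' : a ≠ b := fun h ↦ hab (h ▸ rfl)
    have h1 := congrArg (ρ (swap a b)) hc
    rw [map_zero, map_sum] at h1
    simp_rw [map_smul, hw] at h1
    have h2 : ∑ i, (c i • w i - c i • w (swap a b i)) = (c a - c b) • (w a - w b) := by
      rw [Finset.sum_eq_add a b hab']
      · rw [swap_apply_left, swap_apply_right]; module
      · intro i _ hi
        rw [swap_apply_of_ne_of_ne hi.1 hi.2, sub_self]
      · simp
      · simp
    rw [Finset.sum_sub_distrib, hc, h1, sub_zero] at h2
    rcases smul_eq_zero.1 h2.symm with h | h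
    · exact hab (sub_eq_zero.1 h)
    · exact hne a b hab' (sub_eq_zero.1 h)
  let W : Submodule ℂ V := Submodule.span ℂ (Set.range w)
  have hwW : ∀ a, w a ∈ W := fun a ↦ Submodule.subset_span ⟨a, rfl⟩
  have hW : ∀ g, ∀ v ∈ W, ρ g v ∈ W := by
    intro g v hv
    induction hv using Submodule.span_induction with
    | mem v hv =>
      obtain ⟨a, rfl⟩ := hv
      rw [hw]; exact hwW _
    | zero => simp
    | add v v' _ _ h h' => rw [map_add]; exact add_mem h h'
    | smul c v _ h => rw [map_smul]; exact W.smul_mem c h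
  let ψ : (α → ℂ) →ₗ[ℂ] W × ℂ :=
    (Fintype.linearCombination ℂ fun a ↦ (⟨w a, hwW a⟩ : W)).prod
      (Fintype.linearCombination ℂ fun _ ↦ (1 : ℂ))
  have hψ1 : ∀ c, ((ψ c).1 : V) = ∑ a, c a • w a := fun c ↦ by
    simp [ψ, Fintype.linearCombination_apply]
  have hψ2 : ∀ c, (ψ c).2 = ∑ a, c a := fun c ↦ by
    simp [ψ, Fintype.linearCombination_apply]
  have hcard : (Fintype.card α : ℂ) ≠ 0 := by
    have : 0 < Fintype.card α := Fintype.card_pos_iff.2 ⟨x⟩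
    exact_mod_cast this.ne'
  have hinj : Function.Injective ψ := by
    rw [injective_iff_map_eq_zero]
    intro c hc
    have hc1 := hconst c (by rw [← hψ1, hc]; rfl)
    have hc2 : ∑ a, c a = 0 := by rw [← hψ2, hc]; rfl
    ext a
    rw [Finset.sum_congr rfl fun b _ ↦ hc1 b a, Finset.sum_const, Finset.card_univ,
      nsmul_eq_mul] at hc2
    exact (mul_eq_zero.1 hc2).resolve_left hcard
  have hsurj : Function.Surjective ψ := by
    rintro ⟨⟨v, hv⟩, t⟩
    obtain ⟨c, hc⟩ := (Submodule.mem_span_range_iff_exists_fun ℂ).1 hv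
    refine ⟨fun a ↦ c a + (t - ∑ b, c b) / Fintype.card α, Prod.ext (Subtype.ext ?_) ?_⟩
    · rw [hψ1]
      simp_rw [add_smul]
      rw [Finset.sum_add_distrib, hc, ← Finset.smul_sum, hsum, smul_zero, add_zero]
    · rw [hψ2, Finset.sum_add_distrib, Finset.sum_const, Finset.card_univ, nsmul_eq_mul,
        mul_div_cancel₀ _ hcard]
      ring
  let e := LinearEquiv.ofBijective ψ ⟨hinj, hsurj⟩
  have : FiniteDimensional ℂ W := FiniteDimensional.span_of_finite ℂ (Set.finite_range w)
  refine ⟨W, hW, ?_, fun σ ↦ ?_⟩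
  · have := e.finrank_eq
    rw [Module.finrank_fintype_fun_eq_card, Module.finrank_prod, Module.finrank_self] at this
    exact this.symm
  · have hconj : e.conj (LinearMap.funLeft ℂ ℂ σ.symm) =
        ((ρ σ).restrict (hW σ)).prodMap (LinearMap.id : ℂ →ₗ[ℂ] ℂ) := by
      refine LinearMap.ext fun y ↦ ?_
      obtain ⟨c, rfl⟩ := e.surjective y
      rw [LinearEquiv.conj_apply_apply, LinearEquiv.symm_apply_apply]
      refine Prod.ext (Subtype.ext ?_) ?_
      · change ((ψ _).1 : V) = ρ σ ((ψ c).1 : V)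
        rw [hψ1, hψ1, map_sum, ← Equiv.sum_comp σ]
        simp [LinearMap.funLeft_apply, hw]
      · change (ψ _).2 = (ψ c).2
        rw [hψ2, hψ2, ← Equiv.sum_comp σ]
        simp [LinearMap.funLeft_apply]
    have htr := LinearMap.trace_conj' (LinearMap.funLeft ℂ ℂ σ.symm) e
    rw [hconj, LinearMap.trace_prodMap', LinearMap.trace_id, Module.finrank_self,
      Nat.cast_one] at htr
    rw [htr, LinearMap.trace_eq_matrix_trace ℂ (Pi.basisFun ℂ α), Matrix.trace,
      Finset.card_filter]
    push_cast
    refine Finset.sum_congr rfl fun a _ ↦ ?_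
    rw [Matrix.diag_apply, LinearMap.toMatrix_apply, Pi.basisFun_apply, Pi.basisFun_repr,
      LinearMap.funLeft_apply, Pi.single_apply]
    exact if_congr (Equiv.symm_apply_eq σ |>.trans eq_comm) rfl rfl

/-- The twist of a representation by the sign character. -/
def signTwist (ρ : Representation ℂ (Perm α) V) : Representation ℂ (Perm α) V where
  toFun g := ((Perm.sign g : ℤ) : ℂ) • ρ g
  map_one' := by simp
  map_mul' g h := by
    rw [map_mul ρ, Perm.sign_mul, smul_mul_smul_comm]
    push_cast
    rfl

theorem units_smul_smul {V : Type*} [AddCommGroup V] [Module ℂ V] (s : ℤˣ) (v : V) : ((s : ℤ) : ℂ) • ((s : ℤ) : ℂ) • v = v := by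
  rcases Int.units_eq_one_or s with rfl | rfl <;> simp

theorem exists_standard_signTwist {ρ : Representation ℂ (Perm α) V}
    (hρ : ∀ v, (∀ g, ρ g v = ((Perm.sign g : ℤ) : ℂ) • v) → v = 0) (x : α) {u : V} (hu0 : u ≠ 0)
    (hu : ∀ g : Perm α, g x = x → ρ g u = ((Perm.sign g : ℤ) : ℂ) • u) :
    ∃ (W : Submodule ℂ V) (h : ∀ g, ∀ v ∈ W, ρ g v ∈ W),
      finrank ℂ W + 1 = Fintype.card α ∧
      ∀ σ : Perm α, LinearMap.trace ℂ W ((ρ σ).restrict (h σ)) = ((Perm.sign σ : ℤ) : ℂ) *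
        ((Finset.univ.filter fun a ↦ σ a = a).card - 1) := by
  obtain ⟨W, h, hdim, htr⟩ := exists_standard_subrepresentation_s10 (ρ := signTwist ρ)
    (fun v hv ↦ hρ v fun g ↦ by
      conv_rhs => rw [← hv g]
      exact (units_smul_smul _ _).symm) x hu0
    (fun g hg ↦ by
      change ((Perm.sign g : ℤ) : ℂ) • ρ g u = u
      rw [hu g hg, units_smul_smul])
  have hmem : ∀ g, ∀ v ∈ W, ρ g v ∈ W := fun g v hv ↦ by
    rw [← units_smul_smul (Perm.sign g) (ρ g v)]
    exact W.smul_mem _ (h g v hv)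
  refine ⟨W, hmem, hdim, fun σ ↦ ?_⟩
  have : (ρ σ).restrict (hmem σ) = ((Perm.sign σ : ℤ) : ℂ) • (signTwist ρ σ).restrict (h σ) := by
    ext v
    exact (units_smul_smul _ _).symm
  rw [this, map_smul, ← htr σ, smul_eq_mul, add_sub_cancel_right]

end Standard

theorem Equiv.Perm.card_filter_fixed {α : Type*} [Fintype α] [DecidableEq α] (σ : Perm α) :
    (Finset.univ.filter fun a ↦ σ a = a).card + σ.support.card = Fintype.card α := by
  have := Finset.card_filter_add_card_filter_not (s := Finset.univ) fun a ↦ σ a = a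
  rwa [Finset.card_univ] at this

section Induction

variable {α : Type} [Fintype α] [DecidableEq α]

theorem exists_invariant_submodule_of_not_noLinearConstituent {V : Type*} [AddCommGroup V]
    [Module ℂ V] {ρ : Representation ℂ (Perm α) V} (hρ : NoLinearConstituent ρ) (x : α)
    (h : ¬ NoLinearConstituent (ρ.comp (Perm.ofSubtype (p := (· ≠ x))))) {σ : Perm α}
    (hσ : σ x = x) :
    ∃ (W : Submodule ℂ V) (h : ∀ g, ∀ v ∈ W, ρ g v ∈ W),
      finrank ℂ W + 1 = Fintype.card α ∧
      (LinearMap.trace ℂ W ((ρ σ).restrict (h σ))).re ≤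
        (Finset.univ.filter fun a ↦ σ a = a).card - 1 := by
  have hsub : ∀ g : Perm α, g x = x → ∃ g' : Perm {y // y ≠ x}, Perm.ofSubtype g' = g :=
    fun g hg ↦ ⟨g.subtypePerm fun y ↦ by rw [ne_eq, ne_eq, ← hg, g.apply_eq_iff_eq, hg],
      Perm.ofSubtype_subtypePerm _ fun y hy hyx ↦ hy (hyx ▸ hg)⟩
  have hpos : 1 ≤ (Finset.univ.filter fun a ↦ σ a = a).card :=
    Finset.card_pos.2 ⟨x, by simpa using hσ⟩
  have hpos' : (1 : ℝ) ≤ (Finset.univ.filter fun a ↦ σ a = a).card := by exact_mod_cast hpos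
  rw [NoLinearConstituent, not_and_or] at h
  rcases h with h | h <;> push Not at h <;> obtain ⟨u, hu, hu0⟩ := h
  · obtain ⟨W, hW, hdim, htr⟩ := exists_standard_subrepresentation_s10 hρ.1 x hu0 fun g hg ↦ by
      obtain ⟨g', rfl⟩ := hsub g hg
      exact hu g'
    refine ⟨W, hW, hdim, ?_⟩
    rw [eq_sub_of_add_eq (htr σ)]
    simp
  · obtain ⟨W, hW, hdim, htr⟩ := exists_standard_signTwist hρ.2 x hu0 fun g hg ↦ by
      obtain ⟨g', rfl⟩ := hsub g hg
      rw [Perm.sign_ofSubtype]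
      exact hu g'
    refine ⟨W, hW, hdim, ?_⟩
    rw [htr σ]
    rcases Int.units_eq_one_or (Perm.sign σ) with hs | hs <;> rw [hs]
    · simp
    · simp
      linarith

/-- A bound on normalized characters of the stabilizer of a point passes to the whole symmetric
group as long as it holds for the standard representation. -/
theorem BoundsNormChar.of_ofSubtype {x : α} {τ : Perm {y // y ≠ x}} {c : ℝ}
    (hτ : BoundsNormChar τ c) (hα : 2 ≤ Fintype.card α)
    (hc : ((Finset.univ.filter fun a ↦ Perm.ofSubtype τ a = a).card : ℝ) - 1 ≤
      c * (Fintype.card α - 1)) :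
    BoundsNormChar (Perm.ofSubtype τ) c := by
  suffices ∀ (d : ℕ) (V : Type) [AddCommGroup V] [Module ℂ V] [FiniteDimensional ℂ V]
      (ρ : Representation ℂ (Perm α) V), NoLinearConstituent ρ → finrank ℂ V = d →
        (LinearMap.trace ℂ V (ρ (Perm.ofSubtype τ))).re ≤ c * finrank ℂ V from
    fun V _ _ _ ρ hρ ↦ this _ V ρ hρ rfl
  intro d
  induction d using Nat.strong_induction_on with
  | _ d ih =>
    intro V _ _ _ ρ hρ hd
    by_cases h : NoLinearConstituent (ρ.comp (Perm.ofSubtype (p := (· ≠ x))))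
    · exact hτ V _ h
    · obtain ⟨W, hW, hdim, htr⟩ := exists_invariant_submodule_of_not_noLinearConstituent hρ x h
        (Perm.ofSubtype_apply_of_not_mem τ (by simp))
      have : NeZero (Nat.card (Perm α) : ℂ) := ⟨by exact_mod_cast Nat.card_pos.ne'⟩
      obtain ⟨W', hWW'⟩ := exists_isCompl (⟨W, hW⟩ : Subrepresentation ρ)
      have hcompl : IsCompl W W'.toSubmodule := by
        constructor
        · exact disjoint_iff.2 (congrArg Subrepresentation.toSubmodule hWW'.inf_eq_bot)
        · exact codisjoint_iff.2 (congrArg Subrepresentation.toSubmodule hWW'.sup_eq_top)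
      have hfin := Submodule.finrank_add_eq_of_isCompl hcompl
      have h1 := ih _ (by omega) W'.toSubmodule W'.toRepresentation
        (hρ.subrepresentation W') rfl
      rw [trace_eq_add_of_isCompl_s10 hcompl (ρ (Perm.ofSubtype τ)) (hW _)
        (W'.apply_mem_toSubmodule _), Complex.add_re, ← hfin]
      have h2 : (finrank ℂ W : ℝ) = Fintype.card α - 1 := by
        rw [← hdim]; push_cast; ring
      push_cast
      rw [mul_add, h2]
      exact add_le_add (htr.trans hc) h1

end Induction

theorem boundsNormChar_of_card_le {m : ℕ} {c : ℝ} (hm : 2 ≤ m)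
    (h : ∀ (α : Type) [Fintype α] [DecidableEq α], Fintype.card α = m →
      ∀ (σ : Perm α) (x z : α), σ x ≠ x → σ z = z → BoundsNormChar σ c)
    {n : ℕ} (hmn : m ≤ n) (α : Type) [Fintype α] [DecidableEq α] (hα : Fintype.card α = n)
    (σ : Perm α) (hσ : σ ≠ 1) (hσm : σ.support.card < m) (hc1 : c ≤ 1)
    (hc : (n : ℝ) - σ.support.card - 1 ≤ c * (n - 1)) : BoundsNormChar σ c := by
  induction n, hmn using Nat.le_induction generalizing α with
  | base =>
    obtain ⟨x, hx⟩ := Finset.nonempty_iff_ne_empty.2 (mt Perm.support_eq_empty_iff.1 hσ)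
    obtain ⟨z, hz⟩ : ∃ z, z ∉ σ.support := by
      by_contra! hall
      rw [Finset.eq_univ_iff_forall.2 hall, Finset.card_univ] at hσm
      omega
    exact h α hα σ x z (Perm.mem_support.1 hx) (Perm.notMem_support.1 hz)
  | succ n hmn ih =>
    obtain ⟨x, hx⟩ : ∃ x, x ∉ σ.support := by
      by_contra! hall
      rw [Finset.eq_univ_iff_forall.2 hall, Finset.card_univ] at hσm
      omega
    rw [Perm.notMem_support] at hx
    obtain ⟨τ, rfl⟩ : ∃ τ : Perm {y // y ≠ x}, Perm.ofSubtype τ = σ :=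
      ⟨σ.subtypePerm fun y ↦ by rw [ne_eq, ne_eq, ← hx, σ.apply_eq_iff_eq, hx],
        Perm.ofSubtype_subtypePerm _ fun y hy hyx ↦ hy (hyx ▸ hx)⟩
    have hsupp : (Perm.ofSubtype τ).support.card = τ.support.card := by
      rw [Perm.support_ofSubtype, Finset.card_map]
    rw [hsupp] at hσm hc
    push_cast at hc
    refine BoundsNormChar.of_ofSubtype (ih _ ?_ τ ?_ hσm ?_) (by omega) ?_
    · rw [Fintype.card_subtype_compl, hα, Fintype.card_subtype_eq, Nat.add_sub_cancel]
    · rintro rfl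
      exact hσ (map_one _)
    · linarith
    · have := Perm.card_filter_fixed (Perm.ofSubtype τ)
      rw [hsupp, hα] at this
      have h2 : ((Finset.univ.filter fun a ↦ Perm.ofSubtype τ a = a).card : ℝ) =
          n + 1 - τ.support.card := eq_sub_of_add_eq (by exact_mod_cast this)
      rw [h2, hα]
      push_cast
      linarith

/-- **Corollary (small support).** For every constant `M` there is `N₄ = N₄(M)` such that
for every `n ≥ N₄` and every `σ ∈ S_n` with `|supp(σ)| ≤ M`, the standard representation
rules for `σ` in `S_n`: `χ̃(σ) ≤ (c₁(σ)-1)/(n-1)` for every irreducible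
`χ ∉ {triv, sgn}`. -/
theorem std_rules_of_small_support (M : ℕ) :
    ∃ N₄ : ℕ, ∀ n : ℕ, n ≥ N₄ → ∀ σ : Equiv.Perm (Fin n), σ.support.card ≤ M →
      ∀ V : FDRep ℂ (Equiv.Perm (Fin n)), IsNontrivIrr V →
        normChar V σ ≤ ((fixCount σ : ℝ) - 1) / ((n : ℝ) - 1) := by
  obtain ⟨c, hc1, hc⟩ := exists_boundsNormChar (M + 2)
  obtain ⟨K, hK⟩ := exists_nat_ge (M / (1 - c))
  refine ⟨max (M + 2) (K + 1), fun n hn σ hσ V hV ↦ ?_⟩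
  have hnM : M + 2 ≤ n := (le_max_left _ _).trans hn
  have hnK : K + 1 ≤ n := (le_max_right _ _).trans hn
  have hnM' : (M : ℝ) + 2 ≤ n := by exact_mod_cast hnM
  have hnK' : (K : ℝ) + 1 ≤ n := by exact_mod_cast hnK
  have hn1 : (0 : ℝ) < n - 1 := by linarith [(Nat.cast_nonneg M : (0 : ℝ) ≤ M)]
  have hσ' : (σ.support.card : ℝ) ≤ M := by exact_mod_cast hσ
  have hfix : (fixCount σ : ℝ) = n - σ.support.card := by
    have := Perm.card_filter_fixed σ
    rw [Fintype.card_fin] at this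
    exact eq_sub_of_add_eq (by exact_mod_cast this)
  set C : ℝ := ((fixCount σ : ℝ) - 1) / (n - 1) with hC
  have hCn : C * (n - 1) = n - σ.support.card - 1 := by
    rw [hC, div_mul_cancel₀ _ hn1.ne', hfix]
  have hdim : V.character 1 = ((finrank ℂ V : ℝ) : ℂ) := by simp [FDRep.char_one]
  rw [normChar, hdim, Complex.div_ofReal_re]
  have hC0 : 0 ≤ C := div_nonneg (by linarith) hn1.le
  refine div_le_of_le_mul₀ (Nat.cast_nonneg _) hC0 ?_
  by_cases h1 : σ = 1
  · have : C = 1 := by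
      rw [hC, hfix, h1]; simp [hn1.ne']
    rw [this, h1, hdim]
    simp
  have hC1 : C ≤ 1 := by
    rw [hC, div_le_one hn1, hfix]
    linarith [(Nat.cast_nonneg σ.support.card : (0 : ℝ) ≤ _)]
  have hcC : c ≤ C := by
    rw [hC, le_div_iff₀ hn1, hfix]
    have : (M : ℝ) ≤ (n - 1) * (1 - c) := by
      rw [← div_le_iff₀ (by linarith)]
      linarith
    linarith
  refine boundsNormChar_of_card_le (m := M + 2) (by omega) (fun α _ _ hα τ x z hx hz ↦ ?_) hnM _
    (Fintype.card_fin n) σ h1 (by omega) hC1 hCn.ge V V.ρ hV.noLinearConstituent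
  intro U _ _ _ ρ hρ
  exact (hc α hα τ x z hx hz U ρ hρ).trans
    (mul_le_mul_of_nonneg_right hcC (Nat.cast_nonneg _))
end

section
/- Let n ≥ 13 and let μ be a Young diagram with n boxes that has at least 3 boxes outside its first row and at least 3 boxes outside its first column. Then the number of standard Young tableaux of shape μ is at least n^{2.05}. (Equivalently, every irreducible representation of S_n whose Young diagram has at least three blocks outside the first row and at least three blocks outside the first column has dimension at least n^{2.05}.) -/
/-- A standard Young tableau of shape `μ` (with `μ.card` boxes), encoded as a bijection
from the cells of `μ` to `Fin μ.card`, strictly increasing along each row (left to right)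
and along each column (top to bottom). Cells are pairs `(i, j)` with `i` the row index
and `j` the column index. -/
def IsStandardYT (μ : YoungDiagram) (T : {x // x ∈ μ.cells} ≃ Fin μ.card) : Prop :=
  (∀ a b : {x // x ∈ μ.cells}, a.1.1 = b.1.1 → a.1.2 < b.1.2 → T a < T b) ∧
  (∀ a b : {x // x ∈ μ.cells}, a.1.2 = b.1.2 → a.1.1 < b.1.1 → T a < T b)

namespace YoungDiagram

/-- The number of standard Young tableaux of shape `μ`. -/
noncomputable def numSYT (μ : YoungDiagram) : ℕ :=
  Nat.card {T : {x // x ∈ μ.cells} ≃ Fin μ.card // IsStandardYT μ T}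

/-- `ν` is obtained from `μ` by removing one box. -/
def RemoveBox (ν μ : YoungDiagram) : Prop :=
  ν ≤ μ ∧ ν.card + 1 = μ.card

theorem RemoveBox.eq_of_notMem {ν μ : YoungDiagram} (h : RemoveBox ν μ) {x y : ℕ × ℕ}
    (hx : x ∈ μ.cells) (hy : y ∈ μ.cells) (hx' : x ∉ ν.cells) (hy' : y ∉ ν.cells) : x = y := by
  have hs : ν.cells ⊆ μ.cells := cells_subset_iff.2 h.1
  have hc : (μ.cells \ ν.cells).card ≤ 1 := by
    rw [Finset.card_sdiff_of_subset hs]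
    have := h.2
    simp only [YoungDiagram.card] at this
    omega
  exact Finset.card_le_one.1 hc x (by simp_all) y (by simp_all)

theorem RemoveBox.exists_notMem {ν μ : YoungDiagram} (h : RemoveBox ν μ) :
    ∃ x ∈ μ.cells, x ∉ ν.cells := by
  by_contra! hcon
  have := Finset.card_le_card (s := μ.cells) (t := ν.cells) hcon
  have := h.2
  simp only [YoungDiagram.card] at this
  omega

/-- Extend a filling of `ν` to `μ` by giving the extra box the largest label. -/
def extendFun {ν μ : YoungDiagram} (h : RemoveBox ν μ) (T : {x // x ∈ ν.cells} ≃ Fin ν.card) :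
    {x // x ∈ μ.cells} → Fin μ.card := fun x =>
  if hx : x.1 ∈ ν.cells then ⟨T ⟨x.1, hx⟩, by have := (T ⟨x.1, hx⟩).2; have := h.2; omega⟩
  else ⟨ν.card, by have := h.2; omega⟩

theorem extendFun_of_mem {ν μ : YoungDiagram} (h : RemoveBox ν μ)
    (T : {x // x ∈ ν.cells} ≃ Fin ν.card) (x : {x // x ∈ μ.cells}) (hx : x.1 ∈ ν.cells) :
    (extendFun h T x : ℕ) = T ⟨x.1, hx⟩ := by
  simp [extendFun, hx]

theorem extendFun_of_notMem {ν μ : YoungDiagram} (h : RemoveBox ν μ)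
    (T : {x // x ∈ ν.cells} ≃ Fin ν.card) (x : {x // x ∈ μ.cells}) (hx : x.1 ∉ ν.cells) :
    (extendFun h T x : ℕ) = ν.card := by
  simp [extendFun, hx]

theorem extendFun_bijective {ν μ : YoungDiagram} (h : RemoveBox ν μ)
    (T : {x // x ∈ ν.cells} ≃ Fin ν.card) : Function.Bijective (extendFun h T) := by
  rw [Fintype.bijective_iff_injective_and_card]
  refine ⟨fun x y hxy => ?_, by simp [YoungDiagram.card]⟩
  have hxy' : (extendFun h T x : ℕ) = extendFun h T y := by rw [hxy]
  by_cases hx : x.1 ∈ ν.cells <;> by_cases hy : y.1 ∈ ν.cells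
  · rw [extendFun_of_mem h T x hx, extendFun_of_mem h T y hy] at hxy'
    have := T.injective (Fin.ext hxy')
    exact Subtype.ext (by simpa using this)
  · rw [extendFun_of_mem h T x hx, extendFun_of_notMem h T y hy] at hxy'
    exact absurd (T ⟨x.1, hx⟩).2 (by omega)
  · rw [extendFun_of_notMem h T x hx, extendFun_of_mem h T y hy] at hxy'
    exact absurd (T ⟨y.1, hy⟩).2 (by omega)
  · exact Subtype.ext (h.eq_of_notMem x.2 y.2 hx hy)

theorem extendFun_lt {ν μ : YoungDiagram} (h : RemoveBox ν μ)
    (T : {x // x ∈ ν.cells} ≃ Fin ν.card) {a b : {x // x ∈ μ.cells}} (hne : a ≠ b)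
    (hle : a.1 ≤ b.1)
    (hT : ∀ (ha : a.1 ∈ ν.cells) (hb : b.1 ∈ ν.cells), T ⟨a.1, ha⟩ < T ⟨b.1, hb⟩) :
    extendFun h T a < extendFun h T b := by
  rw [Fin.lt_def]
  by_cases hb : b.1 ∈ ν.cells
  · have ha : a.1 ∈ ν.cells := ν.isLowerSet hle hb
    rw [extendFun_of_mem h T a ha, extendFun_of_mem h T b hb]
    exact hT ha hb
  · by_cases ha : a.1 ∈ ν.cells
    · rw [extendFun_of_mem h T a ha, extendFun_of_notMem h T b hb]
      exact (T ⟨a.1, ha⟩).2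
    · exact absurd (Subtype.ext (h.eq_of_notMem a.2 b.2 ha hb)) hne

/-- Extend a standard tableau of shape `ν` to `μ` by giving the extra box the largest label. -/
noncomputable def extendSYT {ν μ : YoungDiagram} (h : RemoveBox ν μ)
    (T : {T : {x // x ∈ ν.cells} ≃ Fin ν.card // IsStandardYT ν T}) :
    {T : {x // x ∈ μ.cells} ≃ Fin μ.card // IsStandardYT μ T} :=
  ⟨Equiv.ofBijective _ (extendFun_bijective h T.1), by
    refine ⟨fun a b h1 h2 => ?_, fun a b h1 h2 => ?_⟩
    · exact extendFun_lt h T.1 (by rintro rfl; omega) ⟨h1.le, h2.le⟩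
        fun ha hb => T.2.1 ⟨a.1, ha⟩ ⟨b.1, hb⟩ h1 h2
    · exact extendFun_lt h T.1 (by rintro rfl; omega) ⟨h2.le, h1.le⟩
        fun ha hb => T.2.2 ⟨a.1, ha⟩ ⟨b.1, hb⟩ h1 h2⟩

theorem extendSYT_apply {ν μ : YoungDiagram} (h : RemoveBox ν μ)
    (T : {T : {x // x ∈ ν.cells} ≃ Fin ν.card // IsStandardYT ν T}) (x : {x // x ∈ μ.cells}) :
    (extendSYT h T).1 x = extendFun h T.1 x := rfl

theorem extendSYT_injective {ν μ : YoungDiagram} (h : RemoveBox ν μ) :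
    Function.Injective (extendSYT h) := by
  intro T S hTS
  refine Subtype.ext (Equiv.ext fun x => Fin.ext ?_)
  have hx : x.1 ∈ μ.cells := cells_subset_iff.2 h.1 x.2
  have := extendSYT_apply h T ⟨x.1, hx⟩
  rw [hTS, extendSYT_apply] at this
  have := congrArg Fin.val this
  rw [extendFun_of_mem h _ _ x.2, extendFun_of_mem h _ _ x.2] at this
  exact this.symm

theorem numSYT_le_of_removeBox {ν μ : YoungDiagram} (h : RemoveBox ν μ) :
    ν.numSYT ≤ μ.numSYT :=
  Nat.card_le_card_of_injective _ (extendSYT_injective h)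

theorem numSYT_add_le {ν₁ ν₂ μ : YoungDiagram} (h₁ : RemoveBox ν₁ μ) (h₂ : RemoveBox ν₂ μ)
    (hne : ν₁ ≠ ν₂) : ν₁.numSYT + ν₂.numSYT ≤ μ.numSYT := by
  unfold numSYT
  rw [← Nat.card_sum]
  refine Nat.card_le_card_of_injective (Sum.elim (extendSYT h₁) (extendSYT h₂)) ?_
  refine (extendSYT_injective h₁).sumElim (extendSYT_injective h₂) fun T S hTS => hne ?_
  obtain ⟨x, hx, hx₁⟩ := h₁.exists_notMem
  have hx₂ : x ∉ ν₂.cells := by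
    intro hx₂
    have := extendSYT_apply h₁ T ⟨x, hx⟩
    rw [hTS, extendSYT_apply] at this
    have := congrArg Fin.val this
    rw [extendFun_of_mem h₂ _ _ hx₂, extendFun_of_notMem h₁ _ _ hx₁] at this
    have := (S.1 ⟨x, hx₂⟩).2
    have := h₁.2
    have := h₂.2
    omega
  ext y
  constructor
  · intro hy
    by_contra hy₂
    exact hx₁ (h₂.eq_of_notMem hx (h₁.1 hy) hx₂ hy₂ ▸ hy)
  · intro hy
    by_contra hy₁
    exact hx₂ (h₁.eq_of_notMem hx (h₂.1 hy) hx₁ hy₁ ▸ hy)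

theorem card_transpose (μ : YoungDiagram) : μ.transpose.card = μ.card := by
  simp [YoungDiagram.card, transpose]

theorem numSYT_transpose_le (μ : YoungDiagram) : μ.transpose.numSYT ≤ μ.numSYT := by
  let e : {x // x ∈ μ.cells} ≃ {x // x ∈ μ.transpose.cells} :=
    (Equiv.prodComm ℕ ℕ).subtypeEquiv fun x => by simp [mem_transpose]
  let F : {T : {x // x ∈ μ.transpose.cells} ≃ Fin μ.transpose.card //
      IsStandardYT μ.transpose T} → {T : {x // x ∈ μ.cells} ≃ Fin μ.card // IsStandardYT μ T} :=
    fun T => ⟨(e.trans T.1).trans (finCongr μ.card_transpose),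
      fun a b h1 h2 => T.2.2 (e a) (e b) h1 h2, fun a b h1 h2 => T.2.1 (e a) (e b) h1 h2⟩
  refine Nat.card_le_card_of_injective F fun T S hTS => Subtype.ext (Equiv.ext fun x => ?_)
  have := DFunLike.congr_fun (congrArg Subtype.val hTS) (e.symm x)
  simpa [F] using this

theorem exists_removeBox {μ : YoungDiagram} {i j : ℕ} (h : (i, j) ∈ μ) (h₁ : (i + 1, j) ∉ μ)
    (h₂ : (i, j + 1) ∉ μ) :
    ∃ ν : YoungDiagram, RemoveBox ν μ ∧ ∀ x, x ∈ ν ↔ x ∈ μ ∧ x ≠ (i, j) := by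
  have hlow : IsLowerSet ((μ.cells.erase (i, j) : Finset (ℕ × ℕ)) : Set (ℕ × ℕ)) := by
    rintro ⟨a, b⟩ ⟨c, d⟩ hle hab
    simp only [Finset.coe_erase, Set.mem_sdiff, Finset.mem_coe, mem_cells,
      Set.mem_singleton_iff] at hab ⊢
    obtain ⟨hca, hdb⟩ := Prod.mk_le_mk.1 hle
    refine ⟨μ.up_left_mem hca hdb hab.1, fun heq => ?_⟩
    obtain ⟨rfl, rfl⟩ := Prod.mk.inj heq
    rcases hca.lt_or_eq with hlt | rfl
    · exact h₁ (μ.up_left_mem hlt hdb hab.1)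
    · rcases hdb.lt_or_eq with hlt | rfl
      · exact h₂ (μ.up_left_mem le_rfl hlt hab.1)
      · exact hab.2 rfl
  refine ⟨⟨μ.cells.erase (i, j), hlow⟩, ⟨?_, ?_⟩, fun x => ?_⟩
  · exact cells_subset_iff.1 (Finset.erase_subset _ _)
  · exact Finset.card_erase_add_one ((mem_cells _).2 h)
  · rw [← mem_cells]
    simp [and_comm]

theorem rowLen_mono {ν μ : YoungDiagram} (h : ν ≤ μ) (i : ℕ) : ν.rowLen i ≤ μ.rowLen i := by
  by_contra! hlt
  exact absurd (mem_iff_lt_rowLen.1 (h (mem_iff_lt_rowLen.2 hlt))) (lt_irrefl _)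

theorem colLen_mono {ν μ : YoungDiagram} (h : ν ≤ μ) (j : ℕ) : ν.colLen j ≤ μ.colLen j := by
  by_contra! hlt
  exact absurd (mem_iff_lt_colLen.1 (h (mem_iff_lt_colLen.2 hlt))) (lt_irrefl _)

theorem cells_subset_prod (μ : YoungDiagram) :
    μ.cells ⊆ Finset.range (μ.colLen 0) ×ˢ Finset.range (μ.rowLen 0) := by
  rintro ⟨i, j⟩ h
  have h' : (i, j) ∈ μ := h
  simp only [Finset.mem_product, Finset.mem_range]
  exact ⟨mem_iff_lt_colLen.1 (μ.up_left_mem le_rfl (Nat.zero_le j) h'),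
    mem_iff_lt_rowLen.1 (μ.up_left_mem (Nat.zero_le i) le_rfl h')⟩

theorem card_le_mul (μ : YoungDiagram) : μ.card ≤ μ.colLen 0 * μ.rowLen 0 := by
  simpa using Finset.card_le_card μ.cells_subset_prod

theorem mem_of_card_eq_mul {μ : YoungDiagram} (h : μ.card = μ.colLen 0 * μ.rowLen 0) {i j : ℕ}
    (hi : i < μ.colLen 0) (hj : j < μ.rowLen 0) : (i, j) ∈ μ := by
  have := Finset.eq_of_subset_of_card_le μ.cells_subset_prod (by simpa using h.ge)
  rw [← mem_cells, this]
  simp [hi, hj]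

theorem rowLen_add_rowLen_le_card (μ : YoungDiagram) : μ.rowLen 0 + μ.rowLen 1 ≤ μ.card := by
  rw [rowLen_eq_card, rowLen_eq_card, ← Finset.card_union_of_disjoint]
  · exact Finset.card_le_card (by simp [row, Finset.union_subset_iff])
  · rw [Finset.disjoint_left]
    intro c h0 h1
    rw [mem_row_iff] at h0 h1
    omega

theorem rowLen_le_card (μ : YoungDiagram) : μ.rowLen 0 ≤ μ.card :=
  le_trans (Nat.le_add_right _ _) μ.rowLen_add_rowLen_le_card

theorem eq_rowLen_of_one {μ : YoungDiagram} (h : μ.colLen 0 ≤ 1) : μ.card = μ.rowLen 0 :=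
  le_antisymm (μ.card_le_mul.trans (by nlinarith)) μ.rowLen_le_card

/-- The last box of the last row is removable. -/
theorem exists_removeBox_lastRow (μ : YoungDiagram) (h : 0 < μ.colLen 0) :
    ∃ ν j, RemoveBox ν μ ∧ (μ.colLen 0 - 1, j) ∈ μ ∧
      ∀ x, x ∈ ν ↔ x ∈ μ ∧ x ≠ (μ.colLen 0 - 1, j) := by
  have h0 : (μ.colLen 0 - 1, 0) ∈ μ := mem_iff_lt_colLen.2 (by omega)
  have hr := mem_iff_lt_rowLen.1 h0
  have hm : (μ.colLen 0 - 1, μ.rowLen (μ.colLen 0 - 1) - 1) ∈ μ :=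
    mem_iff_lt_rowLen.2 (by omega)
  obtain ⟨ν, hν, hmem⟩ := exists_removeBox hm
    (fun hc => by
      have := mem_iff_lt_colLen.1 (μ.up_left_mem le_rfl (Nat.zero_le _) hc); omega)
    (fun hc => by have := mem_iff_lt_rowLen.1 hc; omega)
  exact ⟨ν, _, hν, hm, hmem⟩

/-- The last box of the last column is removable. -/
theorem exists_removeBox_lastCol (μ : YoungDiagram) (h : 0 < μ.rowLen 0) :
    ∃ ν i, RemoveBox ν μ ∧ (i, μ.rowLen 0 - 1) ∈ μ ∧ (i + 1, μ.rowLen 0 - 1) ∉ μ ∧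
      ∀ x, x ∈ ν ↔ x ∈ μ ∧ x ≠ (i, μ.rowLen 0 - 1) := by
  have h0 : (0, μ.rowLen 0 - 1) ∈ μ := mem_iff_lt_rowLen.2 (by omega)
  have hr := mem_iff_lt_colLen.1 h0
  have hm : (μ.colLen (μ.rowLen 0 - 1) - 1, μ.rowLen 0 - 1) ∈ μ :=
    mem_iff_lt_colLen.2 (by omega)
  have hd : (μ.colLen (μ.rowLen 0 - 1) - 1 + 1, μ.rowLen 0 - 1) ∉ μ :=
    fun hc => by have := mem_iff_lt_colLen.1 hc; omega
  obtain ⟨ν, hν, hmem⟩ := exists_removeBox hm hd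
    (fun hc => by
      have := mem_iff_lt_rowLen.1 (μ.up_left_mem (Nat.zero_le _) le_rfl hc); omega)
  exact ⟨ν, _, hν, hm, hd, hmem⟩

end YoungDiagram

namespace YoungDiagram

theorem numSYT_pos (μ : YoungDiagram) : 0 < μ.numSYT := by
  induction hn : μ.card generalizing μ with
  | zero =>
    have hμ : IsEmpty {x // x ∈ μ.cells} := by
      rw [Finset.card_eq_zero.1 hn]
      exact ⟨fun x => absurd x.2 (Finset.notMem_empty _)⟩
    have hF : IsEmpty (Fin μ.card) := by rw [hn]; infer_instance
    have : Nonempty {T : {x // x ∈ μ.cells} ≃ Fin μ.card // IsStandardYT μ T} :=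
      ⟨⟨Equiv.equivOfIsEmpty _ _, fun a => (hμ.false a).elim, fun a => (hμ.false a).elim⟩⟩
    exact Nat.card_pos
  | succ n ih =>
    have hpos : 0 < μ.colLen 0 := by
      have := μ.card_le_mul
      by_contra! h
      rw [Nat.le_zero.1 h] at this
      omega
    obtain ⟨ν, -, hν, -⟩ := μ.exists_removeBox_lastRow hpos
    exact (ih ν (by have := hν.2; omega)).trans_le (numSYT_le_of_removeBox hν)

theorem rowLen_eq_of_mem {ν μ : YoungDiagram} (h : ν ≤ μ) {i : ℕ}
    (hm : 0 < μ.rowLen i → (i, μ.rowLen i - 1) ∈ ν) : ν.rowLen i = μ.rowLen i := by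
  refine le_antisymm (rowLen_mono h i) ?_
  rcases Nat.eq_zero_or_pos (μ.rowLen i) with h0 | h0
  · omega
  · have := mem_iff_lt_rowLen.1 (hm h0)
    omega

theorem colLen_eq_of_mem {ν μ : YoungDiagram} (h : ν ≤ μ) {j : ℕ}
    (hm : 0 < μ.colLen j → (μ.colLen j - 1, j) ∈ ν) : ν.colLen j = μ.colLen j := by
  refine le_antisymm (colLen_mono h j) ?_
  rcases Nat.eq_zero_or_pos (μ.colLen j) with h0 | h0
  · omega
  · have := mem_iff_lt_colLen.1 (hm h0)
    omega

/-- The number of standard tableaux with `k + 1` boxes outside the first row is at least the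
ballot number `n.choose (k + 1) - n.choose k`. -/
theorem choose_le_numSYT_add {μ : YoungDiagram} {k : ℕ} (hk : μ.rowLen 0 + (k + 1) = μ.card) :
    μ.card.choose (k + 1) ≤ μ.numSYT + μ.card.choose k := by
  induction hn : μ.card generalizing μ k with
  | zero => simp
  | succ m ih =>
    have hcol : 2 ≤ μ.colLen 0 := by
      by_contra! h
      have := μ.eq_rowLen_of_one (by omega)
      omega
    obtain ⟨ν₁, j, hν₁, -, hmem₁⟩ := μ.exists_removeBox_lastRow (by omega)
    have hrow₁ : ν₁.rowLen 0 = μ.rowLen 0 := rowLen_eq_of_mem hν₁.1 fun h =>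
      (hmem₁ _).2 ⟨mem_iff_lt_rowLen.2 (by omega), fun he => by
        have := congrArg Prod.fst he
        simp only at this
        omega⟩
    have hcard₁ := hν₁.2
    have hd₁ : m.choose k + m.choose k ≤ ν₁.numSYT + (m + 1).choose k := by
      rcases k with _ | k
      · have := ν₁.numSYT_pos
        simp only [Nat.choose_zero_right]
        omega
      · have := ih (μ := ν₁) (k := k) (by omega) (by omega)
        rw [Nat.choose_succ_succ']
        omega
    rw [Nat.choose_succ_succ']
    by_cases hlarge : 2 * k + 2 ≤ m
    · have hrow1 := μ.rowLen_add_rowLen_le_card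
      obtain ⟨ν₂, hν₂, hmem₂⟩ := exists_removeBox (μ := μ) (i := 0) (j := μ.rowLen 0 - 1)
        (mem_iff_lt_rowLen.2 (by omega))
        (fun h => by have := mem_iff_lt_rowLen.1 h; simp only [zero_add] at this; omega)
        (fun h => by have := mem_iff_lt_rowLen.1 h; omega)
      have hlt : ν₂.rowLen 0 ≤ μ.rowLen 0 - 1 := by
        by_contra! h
        exact ((hmem₂ _).1 (mem_iff_lt_rowLen.2 h)).2 rfl
      have hge : μ.rowLen 0 - 1 ≤ ν₂.rowLen 0 := by
        by_contra! h
        have := (hmem₂ (0, μ.rowLen 0 - 2)).2 ⟨mem_iff_lt_rowLen.2 (by omega), fun he => by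
          have := congrArg Prod.snd he
          simp only at this
          omega⟩
        have := mem_iff_lt_rowLen.1 this
        omega
      have hcard₂ := hν₂.2
      have hd₂ := ih (μ := ν₂) (k := k) (by omega) (by omega)
      have := numSYT_add_le hν₁ hν₂ (by rintro rfl; omega)
      omega
    · have hle : m.choose (k + 1) ≤ m.choose k := by
        have h := Nat.choose_succ_right_eq m k
        have : m.choose k * (m - k) ≤ m.choose k * (k + 1) := Nat.mul_le_mul_left _ (by omega)
        exact Nat.le_of_mul_le_mul_right (h.trans_le this) (Nat.succ_pos k)
      have := numSYT_le_of_removeBox hν₁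
      omega

/-- A diagram is a rectangle when it fills the product of its first column and first row. -/
def IsRect (μ : YoungDiagram) : Prop := μ.card = μ.colLen 0 * μ.rowLen 0

/-- A diagram of size at least five which is not a rectangle has two distinct subdiagrams with
one box less, the first of which is not a rectangle. -/
theorem exists_removeBox_pair {μ : YoungDiagram} (hcard : 5 ≤ μ.card) (hμ : ¬ μ.IsRect) :
    ∃ ν₁ ν₂, RemoveBox ν₁ μ ∧ RemoveBox ν₂ μ ∧ ν₁ ≠ ν₂ ∧ ¬ ν₁.IsRect := by
  have hle := μ.card_le_mul
  have hcol : 0 < μ.colLen 0 := Nat.pos_of_ne_zero fun h => by rw [h] at hle; omega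
  have hrow : 0 < μ.rowLen 0 := Nat.pos_of_ne_zero fun h => by rw [h] at hle; omega
  have hcorner : (μ.colLen 0 - 1, μ.rowLen 0 - 1) ∉ μ := by
    intro h
    refine hμ (le_antisymm hle ?_)
    have hsub : Finset.range (μ.colLen 0) ×ˢ Finset.range (μ.rowLen 0) ⊆ μ.cells := by
      rintro ⟨i, j⟩ hij
      simp only [Finset.mem_product, Finset.mem_range] at hij
      exact μ.up_left_mem (by omega) (by omega) h
    simpa using Finset.card_le_card hsub
  obtain ⟨ν₁, i, hν₁, hi, hi', hmem₁⟩ := μ.exists_removeBox_lastCol hrow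
  obtain ⟨ν₂, j, hν₂, hj, hmem₂⟩ := μ.exists_removeBox_lastRow hcol
  have hia : i < μ.colLen 0 - 1 := by
    by_contra! h
    exact hcorner (μ.up_left_mem h le_rfl hi)
  have hjb : j < μ.rowLen 0 - 1 := by
    by_contra! h
    exact hcorner (μ.up_left_mem le_rfl h hj)
  have hne : ν₁ ≠ ν₂ := by
    rintro rfl
    refine ((hmem₁ _).1 ((hmem₂ (i, μ.rowLen 0 - 1)).2 ⟨hi, fun he => ?_⟩)).2 rfl
    have := congrArg Prod.fst he
    simp only at this
    omega
  by_cases hr₁ : ν₁.IsRect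
  swap
  · exact ⟨ν₁, ν₂, hν₁, hν₂, hne, hr₁⟩
  by_cases hr₂ : ν₂.IsRect
  swap
  · exact ⟨ν₂, ν₁, hν₂, hν₁, hne.symm, hr₂⟩
  exfalso
  have hcol₁ : ν₁.colLen 0 = μ.colLen 0 := colLen_eq_of_mem hν₁.1 fun _ =>
    (hmem₁ _).2 ⟨mem_iff_lt_colLen.2 (by omega), fun he => by
      have := congrArg Prod.fst he
      simp only at this
      omega⟩
  have hrow₂ : ν₂.rowLen 0 = μ.rowLen 0 := rowLen_eq_of_mem hν₂.1 fun _ =>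
    (hmem₂ _).2 ⟨mem_iff_lt_rowLen.2 (by omega), fun he => by
      have := congrArg Prod.snd he
      simp only at this
      omega⟩
  have hi0 : i = 0 := by
    by_contra h0
    have hrow₁ : ν₁.rowLen 0 = μ.rowLen 0 := rowLen_eq_of_mem hν₁.1 fun _ =>
      (hmem₁ _).2 ⟨mem_iff_lt_rowLen.2 (by omega), fun he => by
        have := congrArg Prod.fst he
        simp only at this
        omega⟩
    exact hcorner (hν₁.1 (mem_of_card_eq_mul hr₁ (by omega) (by omega)))
  have hj0 : j = 0 := by
    by_contra h0
    have hcol₂ : ν₂.colLen 0 = μ.colLen 0 := colLen_eq_of_mem hν₂.1 fun _ =>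
      (hmem₂ _).2 ⟨mem_iff_lt_colLen.2 (by omega), fun he => by
        have := congrArg Prod.snd he
        simp only at this
        omega⟩
    exact hcorner (hν₂.1 (mem_of_card_eq_mul hr₂ (by omega) (by omega)))
  subst hi0 hj0
  have hcol2 : μ.colLen 0 ≤ 2 := by
    by_contra! h
    have h10 : (1, 0) ∈ ν₂ := (hmem₂ _).2 ⟨mem_iff_lt_colLen.2 (by omega), fun he => by
      have := congrArg Prod.fst he
      simp only at this
      omega⟩
    exact hi' (hν₂.1 (mem_of_card_eq_mul hr₂ (mem_iff_lt_colLen.1 h10) (by omega)))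
  have hrow2 : μ.rowLen 0 ≤ 2 := by
    by_contra! h
    have h01 : (0, 1) ∈ ν₁ := (hmem₁ _).2 ⟨mem_iff_lt_rowLen.2 (by omega), fun he => by
      have := congrArg Prod.snd he
      simp only at this
      omega⟩
    have h11 := hν₁.1 (mem_of_card_eq_mul hr₁ (i := μ.colLen 0 - 1) (j := 1) (by omega)
      (mem_iff_lt_rowLen.1 h01))
    have h10 : (μ.colLen 0 - 1, 0) ∉ ν₂ := fun h => ((hmem₂ _).1 h).2 rfl
    have h11' : (μ.colLen 0 - 1, 1) ∈ ν₂ := (hmem₂ _).2 ⟨h11, by simp⟩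
    exact h10 (ν₂.up_left_mem le_rfl (Nat.zero_le 1) h11')
  have := Nat.mul_le_mul hcol2 hrow2
  omega

end YoungDiagram

namespace YoungDiagram

/-- Every diagram with `n` boxes and at least three boxes outside its first row and outside its
first column has at least `b` standard tableaux, and at least `a` if it is not a rectangle. -/
def NumSYTBound (n a b : ℕ) : Prop :=
  ∀ μ : YoungDiagram, μ.card = n → μ.rowLen 0 + 3 ≤ n → μ.colLen 0 + 3 ≤ n →
    b ≤ μ.numSYT ∧ (¬ μ.IsRect → a ≤ μ.numSYT)

theorem choose_three_le_numSYT_add {μ : YoungDiagram}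
    (h : μ.rowLen 0 + 3 = μ.card ∨ μ.colLen 0 + 3 = μ.card) :
    μ.card.choose 3 ≤ μ.numSYT + μ.card.choose 2 := by
  rcases h with h | h
  · exact choose_le_numSYT_add h
  · have := choose_le_numSYT_add (μ := μ.transpose) (k := 2)
      (by rw [rowLen_transpose, card_transpose, h])
    rw [card_transpose] at this
    exact this.trans (Nat.add_le_add_right μ.numSYT_transpose_le _)

theorem NumSYTBound.add_le {n a b : ℕ} (h : NumSYTBound n a b) {μ : YoungDiagram} (hn : 4 ≤ n)
    (hμ : μ.card = n + 1) (hrow : μ.rowLen 0 + 3 ≤ n) (hcol : μ.colLen 0 + 3 ≤ n)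
    (hrect : ¬ μ.IsRect) : a + b ≤ μ.numSYT := by
  obtain ⟨ν₁, ν₂, hν₁, hν₂, hne, hr⟩ := exists_removeBox_pair (by omega) hrect
  have hc₁ := hν₁.2
  have hc₂ := hν₂.2
  have h₁ := (h ν₁ (by omega) (by have := rowLen_mono hν₁.1 0; omega)
    (by have := colLen_mono hν₁.1 0; omega)).2 hr
  have h₂ := (h ν₂ (by omega) (by have := rowLen_mono hν₂.1 0; omega)
    (by have := colLen_mono hν₂.1 0; omega)).1
  exact (add_le_add h₁ h₂).trans (numSYT_add_le hν₁ hν₂ hne)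

/-- Removing the corner of a rectangle with at least two rows and columns. -/
theorem IsRect.exists_removeBox {μ : YoungDiagram} (h : μ.IsRect) (hrow : 2 ≤ μ.rowLen 0)
    (hcol : 2 ≤ μ.colLen 0) :
    ∃ ν, RemoveBox ν μ ∧ ν.rowLen 0 = μ.rowLen 0 ∧ ν.colLen 0 = μ.colLen 0 ∧ ¬ ν.IsRect := by
  obtain ⟨ν, j, hν, hj, hmem⟩ := μ.exists_removeBox_lastRow (by omega)
  have hlast : (μ.colLen 0 - 1, μ.rowLen 0 - 1) ∈ μ :=
    mem_of_card_eq_mul h (by omega) (by omega)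
  have hj' : j = μ.rowLen 0 - 1 := by
    by_contra hj'
    have hjlt := mem_iff_lt_rowLen.1 (μ.up_left_mem (Nat.zero_le _) le_rfl hj)
    have h1 : (μ.colLen 0 - 1, μ.rowLen 0 - 1) ∈ ν := (hmem _).2 ⟨hlast, fun he => by
      have := congrArg Prod.snd he
      simp only at this
      omega⟩
    exact ((hmem _).1 (ν.up_left_mem le_rfl (by omega) h1)).2 rfl
  have hr : ν.rowLen 0 = μ.rowLen 0 := rowLen_eq_of_mem hν.1 fun _ =>
    (hmem _).2 ⟨mem_iff_lt_rowLen.2 (by omega), fun he => by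
      have := congrArg Prod.fst he
      simp only at this
      omega⟩
  have hc : ν.colLen 0 = μ.colLen 0 := colLen_eq_of_mem hν.1 fun _ =>
    (hmem _).2 ⟨mem_iff_lt_colLen.2 (by omega), fun he => by
      have := congrArg Prod.snd he
      simp only at this
      omega⟩
  refine ⟨ν, hν, hr, hc, fun hrect => ?_⟩
  have := hν.2
  unfold IsRect at h hrect
  rw [hr, hc] at hrect
  omega

/-- In a rectangle with at least two rows and columns, at least half of the boxes are outside the
first row, and at least half of them are outside the first column. -/
theorem IsRect.bounds {μ : YoungDiagram} (h : μ.IsRect) (hrow : μ.rowLen 0 < μ.card)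
    (hcol : μ.colLen 0 < μ.card) :
    2 ≤ μ.rowLen 0 ∧ 2 ≤ μ.colLen 0 ∧ 2 * μ.rowLen 0 ≤ μ.card ∧ 2 * μ.colLen 0 ≤ μ.card := by
  unfold IsRect at h
  have h1 : 2 ≤ μ.rowLen 0 := by
    by_contra! h1
    nlinarith
  have h2 : 2 ≤ μ.colLen 0 := by
    by_contra! h2
    nlinarith
  exact ⟨h1, h2, by nlinarith, by nlinarith⟩

theorem NumSYTBound.succ {n a b a' b' : ℕ} (h : NumSYTBound n a b) (hn : 6 ≤ n)
    (ha : a' ≤ a + b) (hchoose : a' + (n + 1).choose 2 ≤ (n + 1).choose 3) (hb : b' ≤ a)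
    (hab : b' ≤ a') : NumSYTBound (n + 1) a' b' := by
  intro μ hμ hrow hcol
  have hnonrect : ¬ μ.IsRect → a' ≤ μ.numSYT := by
    intro hrect
    by_cases h3 : μ.rowLen 0 + 3 = μ.card ∨ μ.colLen 0 + 3 = μ.card
    · have := choose_three_le_numSYT_add h3
      rw [hμ] at this
      omega
    · exact ha.trans (h.add_le (by omega) hμ (by omega) (by omega) hrect)
  refine ⟨?_, hnonrect⟩
  by_cases hrect : μ.IsRect
  · obtain ⟨h1, h2, h3, h4⟩ := hrect.bounds (by omega) (by omega)
    obtain ⟨ν, hν, hr, hc, hνrect⟩ := hrect.exists_removeBox h1 h2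
    have := hν.2
    exact hb.trans (((h ν (by omega) (by omega) (by omega)).2 hνrect).trans
      (numSYT_le_of_removeBox hν))
  · exact hab.trans (hnonrect hrect)

theorem NumSYTBound.add_le_of_isRect {n a b : ℕ} (h : NumSYTBound n a b) {μ : YoungDiagram}
    (hn : 8 ≤ n) (hμ : μ.card = n + 2) (hrow : μ.rowLen 0 < n + 2) (hcol : μ.colLen 0 < n + 2)
    (hrect : μ.IsRect) : a + b ≤ μ.numSYT := by
  obtain ⟨h1, h2, h3, h4⟩ := hrect.bounds (by omega) (by omega)
  obtain ⟨ν, hν, hr, hc, hνrect⟩ := hrect.exists_removeBox h1 h2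
  have := hν.2
  exact (h.add_le (by omega) (by omega) (by omega) (by omega) hνrect).trans
    (numSYT_le_of_removeBox hν)

theorem not_isRect_of_prime {μ : YoungDiagram} (hp : μ.card.Prime)
    (hrow : μ.rowLen 0 < μ.card) (hcol : μ.colLen 0 < μ.card) : ¬ μ.IsRect := by
  intro h
  obtain ⟨h1, h2, -, -⟩ := h.bounds hrow hcol
  exact Nat.not_prime_mul (by omega) (by omega) (h ▸ hp)

theorem NumSYTBound.of_prime {n a b : ℕ} (h : NumSYTBound n a b) (hp : n.Prime) :
    NumSYTBound n a a := by
  intro μ hμ hrow hcol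
  have := (h μ hμ hrow hcol).2 (not_isRect_of_prime (hμ ▸ hp) (by omega) (by omega))
  exact ⟨this, fun _ => this⟩

theorem numSYTBound_six : NumSYTBound 6 5 5 := by
  intro μ hμ hrow hcol
  have h : 5 ≤ μ.numSYT := by
    have h3 : μ.rowLen 0 + 3 = μ.card ∨ μ.colLen 0 + 3 = μ.card := by
      by_contra! h3
      have := Nat.mul_le_mul (show μ.colLen 0 ≤ 2 by omega) (show μ.rowLen 0 ≤ 2 by omega)
      have := μ.card_le_mul
      omega
    have := choose_three_le_numSYT_add h3
    rw [hμ, show Nat.choose 6 3 = 20 from rfl, show Nat.choose 6 2 = 15 from rfl] at this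
    omega
  exact ⟨h, fun _ => h⟩

theorem numSYTBound_twelve : NumSYTBound 12 154 80 := by
  have h7 : NumSYTBound 7 10 10 :=
    (numSYTBound_six.succ (b' := 5) (by decide) (by decide) (by decide) (by decide)
      (by decide)).of_prime (by norm_num)
  have h8 : NumSYTBound 8 20 10 := h7.succ (by decide) (by decide) (by decide) (by decide)
    (by decide)
  have h9 : NumSYTBound 9 30 20 := h8.succ (by decide) (by decide) (by decide) (by decide)
    (by decide)
  have h10 : NumSYTBound 10 50 30 := h9.succ (by decide) (by decide) (by decide) (by decide)
    (by decide)
  have h11 : NumSYTBound 11 80 80 :=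
    (h10.succ (b' := 50) (by decide) (by decide) (by decide) (by decide)
      (by decide)).of_prime (by norm_num)
  exact h11.succ (by decide) (by decide) (by decide) (by decide) (by decide)

theorem six_mul_choose_three_sub (t : ℕ) :
    6 * (t + 5).choose 3 = (t + 5) * (t + 4) * t + 6 * (t + 5).choose 2 := by
  induction t with
  | zero => rfl
  | succ t ih =>
    have h2 : (t + 5).choose 2 * 2 = (t + 5) * (t + 4) := by
      simpa using Nat.choose_succ_right_eq (t + 5) 1
    rw [show t + 1 + 5 = (t + 5) + 1 by ring, Nat.choose_succ_succ' (t + 5) 2,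
      Nat.choose_succ_succ' (t + 5) 1, Nat.choose_one_right]
    linarith

/-- The ballot number `n.choose 3 - n.choose 2` bounds the number of standard tableaux of
non-rectangular diagrams, and its predecessor those of rectangles. -/
theorem numSYTBound_choose (t : ℕ) :
    NumSYTBound (t + 13) ((t + 13).choose 3 - (t + 13).choose 2)
      ((t + 12).choose 3 - (t + 12).choose 2) := by
  induction t with
  | zero =>
    exact numSYTBound_twelve.succ (by decide) (by decide) (by decide) (by decide) (by decide)
  | succ t ih =>
    have h12 := six_mul_choose_three_sub (t + 7)
    have h13 := six_mul_choose_three_sub (t + 8)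
    have h14 := six_mul_choose_three_sub (t + 9)
    simp only [add_assoc, Nat.reduceAdd] at h12 h13 h14
    simp only [show t + 1 + 13 = t + 14 by ring, show t + 1 + 12 = t + 13 by ring]
    have hle : (t + 14) * (t + 13) * (t + 9) ≤
        (t + 13) * (t + 12) * (t + 8) + (t + 12) * (t + 11) * (t + 7) := by
      nlinarith [Nat.zero_le (t ^ 3), Nat.zero_le (t ^ 2), Nat.zero_le t]
    have hmono : (t + 13) * (t + 12) * (t + 8) ≤ (t + 14) * (t + 13) * (t + 9) := by
      gcongr <;> omega
    exact ih.succ (by omega) (by omega) (by simp only [add_assoc, Nat.reduceAdd]; omega)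
      (by omega) (by omega)

end YoungDiagram

theorem rpow_two_point_o_five_le {x : ℝ} (hx : 0 ≤ x) :
    x ^ (2.05 : ℝ) ≤ x ^ 2 * (1.15 * (0.95 + x / 320)) := by
  have h16 : (16 : ℝ) ^ (0.05 : ℝ) ≤ 1.15 := by
    have h : (16 : ℝ) ≤ (1.15 : ℝ) ^ (20 : ℝ) := by norm_num
    calc (16 : ℝ) ^ (0.05 : ℝ) ≤ ((1.15 : ℝ) ^ (20 : ℝ)) ^ (0.05 : ℝ) := by gcongr
      _ = 1.15 := by
        rw [← Real.rpow_mul (by norm_num)]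
        norm_num
  have hB : (x / 16) ^ (0.05 : ℝ) ≤ 0.95 + x / 320 := by
    have := rpow_one_add_le_one_add_mul_self (s := x / 16 - 1) (p := 0.05)
      (by linarith [div_nonneg hx (by norm_num : (0 : ℝ) ≤ 16)]) (by norm_num) (by norm_num)
    calc (x / 16) ^ (0.05 : ℝ) = (1 + (x / 16 - 1)) ^ (0.05 : ℝ) := by ring_nf
      _ ≤ _ := this
      _ = _ := by ring
  have hsplit : x ^ (2.05 : ℝ) = x ^ 2 * (16 ^ (0.05 : ℝ) * (x / 16) ^ (0.05 : ℝ)) := by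
    rw [← Real.mul_rpow (by norm_num) (by positivity), show 16 * (x / 16) = x by ring,
      show (2.05 : ℝ) = 2 + 0.05 by norm_num,
      Real.rpow_add_of_nonneg hx (by norm_num) (by norm_num), Real.rpow_two]
  rw [hsplit]
  gcongr

/-- **Lemma (dimension ≥ n^2.05).** Let `n ≥ 13` and let `μ ⊢ n` be a Young diagram with
at least 3 boxes outside its first row and at least 3 boxes outside its first column. Then
the number of standard Young tableaux of shape `μ` (i.e. the dimension of the corresponding
irreducible representation of `S_n`) is at least `n^2.05`. -/
theorem dim_ge_n_pow_two_point_o_five (n : ℕ) (hn : 13 ≤ n) (μ : YoungDiagram)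
    (hcard : μ.card = n) (hrow : 3 ≤ n - μ.rowLen 0) (hcol : 3 ≤ n - μ.colLen 0) :
    (n : ℝ) ^ (2.05 : ℝ) ≤
      (Nat.card {T : {x // x ∈ μ.cells} ≃ Fin μ.card // IsStandardYT μ T} : ℝ) := by
  have hle := rpow_two_point_o_five_le (x := n) (Nat.cast_nonneg n)
  refine hle.trans ?_
  clear hle
  change _ ≤ (μ.numSYT : ℝ)
  by_cases hrect : μ.IsRect
  · obtain rfl | rfl | h15 : n = 13 ∨ n = 14 ∨ 15 ≤ n := by omega
    · exact absurd hrect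
        (YoungDiagram.not_isRect_of_prime (by rw [hcard]; norm_num) (by omega) (by omega))
    · have h := YoungDiagram.numSYTBound_twelve.add_le_of_isRect (by omega) hcard (by omega)
        (by omega) hrect
      have h' : (154 + 80 : ℝ) ≤ μ.numSYT := by exact_mod_cast h
      push_cast
      linarith
    · obtain ⟨t, rfl⟩ := Nat.exists_eq_add_of_le' h15
      have h := (YoungDiagram.numSYTBound_choose t).add_le_of_isRect (by omega) hcard (by omega)
        (by omega) hrect
      have h12 := YoungDiagram.six_mul_choose_three_sub (t + 7)
      have h13 := YoungDiagram.six_mul_choose_three_sub (t + 8)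
      simp only [add_assoc, Nat.reduceAdd] at h12 h13
      have h' : (t + 13) * (t + 12) * (t + 8) + (t + 12) * (t + 11) * (t + 7) ≤
          6 * μ.numSYT := by omega
      have h'' : ((t + 13) * (t + 12) * (t + 8) + (t + 12) * (t + 11) * (t + 7) : ℝ) ≤
          6 * μ.numSYT := by exact_mod_cast h'
      have ht : (0 : ℝ) ≤ t := Nat.cast_nonneg t
      push_cast
      linarith [pow_nonneg ht 2, pow_nonneg ht 3]
  · obtain ⟨t, rfl⟩ := Nat.exists_eq_add_of_le' hn
    have h := ((YoungDiagram.numSYTBound_choose t) μ hcard (by omega) (by omega)).2 hrect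
    have h13 := YoungDiagram.six_mul_choose_three_sub (t + 8)
    simp only [add_assoc, Nat.reduceAdd] at h13
    have h' : (t + 13) * (t + 12) * (t + 8) ≤ 6 * μ.numSYT := by omega
    have h'' : ((t + 13) * (t + 12) * (t + 8) : ℝ) ≤ 6 * μ.numSYT := by exact_mod_cast h'
    have ht : (0 : ℝ) ≤ t := Nat.cast_nonneg t
    push_cast
    linarith [pow_nonneg ht 2, pow_nonneg ht 3]
end

section
/- There exists N ∈ ℕ such that for every n ≥ N and every σ ∈ S_n: max{F₁(σ), F₂(σ), F₃(σ), F₄(σ), F₅(σ), F₆(σ), F₇(σ), F₈(σ)} ≥ 3/(n(n-2)(n-4)). (That is, the maximum of the normalized characters of σ over the eight irreps of EIGHT_n is at least 3/(n(n-2)(n-4)).) -/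
open CategoryTheory

/-- A fraction with numerator at least `1` and denominator at most `m (m - 2) (m - 4) / 3` is at
least `3 / (m (m - 2) (m - 4))`. -/
theorem three_div_le_div {m x d : ℝ} (hx : 1 ≤ x) (hd : 0 < d)
    (hdm : d ≤ m * (m - 2) * (m - 4) / 3) : 3 / (m * (m - 2) * (m - 4)) ≤ x / d := by
  rw [div_le_div_iff₀ (by linarith) hd]
  nlinarith

/-- **Lemma (the eight are at least `3/(n(n-2)(n-4))`).** There is `N` such that for every
`n ≥ N` and every `σ ∈ S_n`, the maximum of the normalized characters of `σ` over the
eight irreps of `EIGHT_n` is at least `3/(n(n-2)(n-4))`. -/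
theorem maxF_ge :
    ∃ N : ℕ, ∀ n : ℕ, n ≥ N → ∀ σ : Equiv.Perm (Fin n),
      3 / ((n : ℝ) * ((n : ℝ) - 2) * ((n : ℝ) - 4)) ≤ maxF n σ := by
  refine ⟨10, fun n hn σ => ?_⟩
  have hm : (10 : ℝ) ≤ n := by exact_mod_cast hn
  simp only [maxF, le_max_iff]
  generalize (n : ℝ) = m at hm ⊢
  obtain ⟨t, ht, rfl⟩ : ∃ t : ℝ, 0 ≤ t ∧ m = t + 10 := ⟨m - 10, by linarith, by ring⟩
  have ht2 : 0 ≤ t ^ 2 := by positivity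
  have ht3 : 0 ≤ t ^ 3 := by positivity
  rcases lt_trichotomy (fixCount σ) 1 with ha | ha | ha
  · have ha : fixCount σ = 0 := by lia
    simp only [ha]
    rcases Int.units_eq_one_or (Equiv.Perm.sign σ) with he | he
    · simp only [he]
      rcases Nat.eq_zero_or_pos (cyc 2 σ) with hb | hb
      · refine Or.inr (Or.inr (Or.inr (three_div_le_div ?_ ?_ ?_)))
        · norm_num [hb]
        · nlinarith
        · nlinarith
      · have hb : (1 : ℝ) ≤ cyc 2 σ := by exact_mod_cast hb
        refine Or.inl (Or.inl (Or.inr (three_div_le_div ?_ ?_ ?_)))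
        · norm_num; exact_mod_cast hb
        · nlinarith
        · nlinarith
    · refine Or.inr (Or.inl (Or.inr ?_))
      rw [← mul_div_assoc]
      refine three_div_le_div ?_ ?_ ?_
      · norm_num [he]
      · linarith
      · nlinarith
  · simp only [ha]
    rcases Nat.eq_zero_or_pos (cyc 3 σ) with hc | hc
    · refine Or.inl (Or.inr (Or.inr (three_div_le_div ?_ ?_ ?_)))
      · norm_num [hc]
      · have : 0 < (t + 10) * (t + 10 - 2) := by nlinarith
        nlinarith
      · exact le_rfl
    · have hc : (1 : ℝ) ≤ cyc 3 σ := by exact_mod_cast hc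
      refine Or.inl (Or.inr (Or.inl (three_div_le_div ?_ ?_ ?_)))
      · norm_num; exact_mod_cast hc
      · have : 0 < (t + 10) * (t + 10 - 1) := by nlinarith
        nlinarith
      · nlinarith
  · have ha : (2 : ℝ) ≤ fixCount σ := by exact_mod_cast ha
    refine Or.inl (Or.inl (Or.inl (three_div_le_div ?_ ?_ ?_)))
    · linarith
    · linarith
    · nlinarith
end
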